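/- arXiv:2004.02880 — 6 statements merged into one kernel-verified Lean document; each statement's English description precedes it below -/
import Mathlib

section
/- Let n ≥ p ≥ 1. The functions η and η̃ on real n×p matrices are equivalent: there exist constants c₁, c₂ > 0 (depending only on n and p) such that c₁·η̃(A) ≤ η(A) ≤ c₂·η̃(A) for every real n×p matrix A. -/
/-- `M_I(A)`: the `p×p` minor of the `n×p` matrix `A` (here `p = m+1`) given by the rows
indexed by the finset `s` (of cardinality `p`), taken in increasing order; `0` if `s` does
not have cardinality `p`. -/
noncomputable def minorTop {n m : ℕ} (A : Matrix (Fin n) (Fin (m + 1)) ℝ)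
    (s : Finset (Fin n)) : ℝ :=
  if h : s.card = m + 1 then (A.submatrix (fun i => s.orderEmbOfFin h i) id).det else 0

/-- `M_J(j)(A)`: the `(p−1)×(p−1)` minor of `A` (here `p = m+1`) given by the rows indexed
by the finset `s` (of cardinality `p−1`), in increasing order, with the `j`-th column
deleted; `0` if `s` does not have cardinality `p−1`.  When `p = 1` this is the determinant
of the empty matrix, i.e. `1`. -/
noncomputable def minorSub {n m : ℕ} (A : Matrix (Fin n) (Fin (m + 1)) ℝ)
    (s : Finset (Fin n)) (j : Fin (m + 1)) : ℝ :=
  if h : s.card = m then (A.submatrix (fun i => s.orderEmbOfFin h i) j.succAbove).det else 0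

/-- `η(A) = (Σ_I M_I(A)² / Σ_{J,j} M_J(j)(A)²)^{1/2}`, with the convention `0/0 = 0`
(division by zero is zero in Lean). -/
noncomputable def etaFun {n m : ℕ} (A : Matrix (Fin n) (Fin (m + 1)) ℝ) : ℝ :=
  Real.sqrt ((∑ s ∈ Finset.powersetCard (m + 1) Finset.univ, (minorTop A s) ^ 2) /
    (∑ s ∈ Finset.powersetCard m Finset.univ, ∑ j : Fin (m + 1), (minorSub A s j) ^ 2))

/-- `h_I(A) = max{|M_J(j)(A)| : J ⊆ I with card p−1, j = 1,…,p}` (`p = m+1`). -/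
noncomputable def hIFun {n m : ℕ} (A : Matrix (Fin n) (Fin (m + 1)) ℝ)
    (s : Finset (Fin n)) : ℝ :=
  ⨆ J : {J : Finset (Fin n) // J ⊆ s ∧ J.card = m}, ⨆ j : Fin (m + 1), |minorSub A J j|

/-- `η̃(A) = max_I |M_I(A)|/h_I(A)` with the convention `0/0 = 0`. -/
noncomputable def etaTildeFun {n m : ℕ} (A : Matrix (Fin n) (Fin (m + 1)) ℝ) : ℝ :=
  ⨆ s : {s : Finset (Fin n) // s.card = m + 1}, |minorTop A s| / hIFun A s

/-- The top-degree minors of `A` dominate every determinant of rows of `A`, repeated or not. -/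
lemma sq_det_submatrix_le_sum {n m : ℕ} (A : Matrix (Fin n) (Fin (m + 1)) ℝ)
    (f : Fin (m + 1) → Fin n) :
    (A.submatrix f id).det ^ 2 ≤
      ∑ s ∈ Finset.powersetCard (m + 1) Finset.univ, (minorTop A s) ^ 2 := by
  by_cases hf : Function.Injective f
  · have hs : (Finset.univ.image f).card = m + 1 := by
      rw [Finset.card_image_of_injective _ hf, Finset.card_fin]
    let e := (Finset.univ.image f).orderIsoOfFin hs
    let σ : Fin (m + 1) → Fin (m + 1) := fun i => e.symm ⟨f i, by simp⟩
    have hσ : Function.Injective σ := fun i j hij =>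
      hf (congrArg Subtype.val (e.symm.injective hij))
    let τ : Equiv.Perm (Fin (m + 1)) := Equiv.ofBijective σ (Finite.injective_iff_bijective.mp hσ)
    have hcomp : A.submatrix f id =
        (A.submatrix (fun i => (Finset.univ.image f).orderEmbOfFin hs i) id).submatrix τ id := by
      ext i j
      have : (Finset.univ.image f).orderEmbOfFin hs (σ i) = f i := by
        rw [← Finset.coe_orderIsoOfFin_apply]
        exact congrArg Subtype.val (e.apply_symm_apply ⟨f i, by simp⟩)
      simp [τ, this]
    have hsq : (A.submatrix f id).det ^ 2 = minorTop A (Finset.univ.image f) ^ 2 := by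
      rw [hcomp, Matrix.det_permute, minorTop, dif_pos hs, mul_pow]
      rcases Int.units_eq_one_or (Equiv.Perm.sign τ) with h | h <;> simp [h]
    rw [hsq]
    exact Finset.single_le_sum (f := fun s => minorTop A s ^ 2) (fun s _ => sq_nonneg _)
      (Finset.mem_powersetCard.mpr ⟨Finset.subset_univ _, hs⟩)
  · obtain ⟨i, j, hij, hne⟩ : ∃ i j, f i = f j ∧ i ≠ j := by
      simpa [Function.Injective] using hf
    rw [Matrix.det_zero_of_row_eq hne (by ext k; simp [hij])]
    simpa using Finset.sum_nonneg fun s _ => sq_nonneg (minorTop A s)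

lemma abs_minorSub_le_hIFun {n m : ℕ} (A : Matrix (Fin n) (Fin (m + 1)) ℝ)
    {s J : Finset (Fin n)} (hJ : J ⊆ s) (hc : J.card = m) (j : Fin (m + 1)) :
    |minorSub A J j| ≤ hIFun A s :=
  (le_ciSup (f := fun j => |minorSub A J j|) (Set.finite_range _).bddAbove j).trans
    (le_ciSup (f := fun J : {J : Finset (Fin n) // J ⊆ s ∧ J.card = m} =>
      ⨆ j : Fin (m + 1), |minorSub A J j|) (Set.finite_range _).bddAbove ⟨J, hJ, hc⟩)

lemma hIFun_nonneg {n m : ℕ} (A : Matrix (Fin n) (Fin (m + 1)) ℝ) (s : Finset (Fin n)) :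
    0 ≤ hIFun A s :=
  Real.iSup_nonneg fun _ => Real.iSup_nonneg fun _ => abs_nonneg _

lemma etaTildeFun_nonneg {n m : ℕ} (A : Matrix (Fin n) (Fin (m + 1)) ℝ) : 0 ≤ etaTildeFun A :=
  Real.iSup_nonneg fun s => div_nonneg (abs_nonneg _) (hIFun_nonneg A s)

lemma sq_hIFun_le_sum {n m : ℕ} (A : Matrix (Fin n) (Fin (m + 1)) ℝ) (s : Finset (Fin n)) :
    hIFun A s ^ 2 ≤ ∑ J ∈ Finset.powersetCard m Finset.univ,
      ∑ j : Fin (m + 1), (minorSub A J j) ^ 2 := by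
  have hS : 0 ≤ ∑ J ∈ Finset.powersetCard m Finset.univ,
      ∑ j : Fin (m + 1), (minorSub A J j) ^ 2 :=
    Finset.sum_nonneg fun _ _ => Finset.sum_nonneg fun _ _ => sq_nonneg _
  refine (Real.le_sqrt (hIFun_nonneg A s) hS).mp ?_
  refine Real.iSup_le (fun J => Real.iSup_le (fun j => Real.abs_le_sqrt ?_) (Real.sqrt_nonneg _))
    (Real.sqrt_nonneg _)
  calc minorSub A J j ^ 2 ≤ ∑ j : Fin (m + 1), minorSub A J j ^ 2 :=
        Finset.single_le_sum (f := fun j => minorSub A J j ^ 2) (fun _ _ => sq_nonneg _)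
          (Finset.mem_univ j)
    _ ≤ _ := Finset.single_le_sum (f := fun J => ∑ j : Fin (m + 1), minorSub A J j ^ 2)
        (fun _ _ => Finset.sum_nonneg fun _ _ => sq_nonneg _)
        (Finset.mem_powersetCard.mpr ⟨Finset.subset_univ _, J.2.2⟩)

lemma abs_adjugate_le_hIFun {n m : ℕ} (A : Matrix (Fin n) (Fin (m + 1)) ℝ)
    {s : Finset (Fin n)} (hs : s.card = m + 1) (i j : Fin (m + 1)) :
    |(A.submatrix (fun k => s.orderEmbOfFin hs k) id).adjugate j i| ≤ hIFun A s := by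
  let g : Fin m ↪o Fin n := (Fin.succAboveOrderEmb i).trans (s.orderEmbOfFin hs)
  have hc : (Finset.univ.map g.toEmbedding).card = m := by simp
  have hsub : Finset.univ.map g.toEmbedding ⊆ s := by
    intro x hx
    obtain ⟨k, -, rfl⟩ := Finset.mem_map.mp hx
    exact s.orderEmbOfFin_mem hs _
  have hg : (g : Fin m → Fin n) = (Finset.univ.map g.toEmbedding).orderEmbOfFin hc :=
    Finset.orderEmbOfFin_unique hc (fun k => Finset.mem_map_of_mem _ (Finset.mem_univ k))
      g.strictMono
  refine le_trans (le_of_eq ?_) (abs_minorSub_le_hIFun A hsub hc j)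
  rw [Matrix.adjugate_fin_succ_eq_det_submatrix, minorSub, dif_pos hc, abs_mul, abs_pow,
    abs_neg, abs_one, one_pow, one_mul, ← hg]
  rfl

lemma minorTop_eq_zero_of_hIFun_eq_zero {n m : ℕ} (A : Matrix (Fin n) (Fin (m + 1)) ℝ)
    (s : Finset (Fin n)) (h : hIFun A s = 0) : minorTop A s = 0 := by
  unfold minorTop
  split_ifs with hs
  · have hadj : (A.submatrix (fun k => s.orderEmbOfFin hs k) id).adjugate = 0 := by
      ext j i
      simpa [h] using abs_adjugate_le_hIFun A hs i j
    have := congrFun (congrFun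
      (Matrix.mul_adjugate (A.submatrix (fun k => s.orderEmbOfFin hs k) id)) 0) 0
    simpa [hadj, eq_comm] using this
  · rfl

/-- Expanding the cofactors of `m` rows of `A` in terms of the rows of `s` by Cramer's rule. -/
lemma abs_minorTop_mul_abs_minorSub_le {n m : ℕ} (A : Matrix (Fin n) (Fin (m + 1)) ℝ)
    {s J : Finset (Fin n)} (hs : s.card = m + 1) (hJ : J.card = m) (j : Fin (m + 1)) :
    |minorTop A s| * |minorSub A J j| ≤ (m + 1) * (hIFun A s *
      √(∑ K ∈ Finset.powersetCard (m + 1) Finset.univ, (minorTop A K) ^ 2)) := by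
  set T := ∑ K ∈ Finset.powersetCard (m + 1) Finset.univ, (minorTop A K) ^ 2
  set B := A.submatrix (fun k => s.orderEmbOfFin hs k) id with hB
  let v : Fin (m + 1) → ℝ := fun j => (-1) ^ (j : ℕ) * minorSub A J j
  let E : Fin (m + 1) → ℝ := fun i =>
    (A.submatrix (Fin.cons (s.orderEmbOfFin hs i) (fun k => J.orderEmbOfFin hJ k)) id).det
  have hE : B.mulVec v = E := by
    ext i
    simp only [E, Matrix.det_succ_row_zero, Matrix.mulVec, dotProduct]
    refine Finset.sum_congr rfl fun k _ => ?_
    have : ((A.submatrix (Fin.cons (s.orderEmbOfFin hs i) (fun k => J.orderEmbOfFin hJ k)) id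
        ).submatrix Fin.succ k.succAbove) =
        A.submatrix (fun k => J.orderEmbOfFin hJ k) k.succAbove := by
      ext a b
      simp
    rw [this]
    simp only [v, minorSub, dif_pos hJ, hB, Matrix.submatrix_apply, Fin.cons_zero, id]
    ring
  have hcramer : B.det * v j = ∑ i, B.adjugate j i * E i := by
    have := congrFun (congrArg B.adjugate.mulVec hE) j
    rw [Matrix.mulVec_mulVec, Matrix.adjugate_mul, Matrix.smul_mulVec, Matrix.one_mulVec] at this
    exact this
  have hv : |v j| = |minorSub A J j| := by simp [v, abs_mul]
  have htop : minorTop A s = B.det := dif_pos hs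
  rw [htop, ← hv, ← abs_mul, hcramer]
  calc |∑ i, B.adjugate j i * E i| ≤ ∑ i, |B.adjugate j i * E i| :=
        Finset.abs_sum_le_sum_abs _ _
    _ ≤ ∑ _i : Fin (m + 1), hIFun A s * √T := by
        refine Finset.sum_le_sum fun i _ => ?_
        rw [abs_mul]
        exact mul_le_mul (abs_adjugate_le_hIFun A hs i j)
          (Real.abs_le_sqrt (sq_det_submatrix_le_sum A _)) (abs_nonneg _) (hIFun_nonneg A s)
    _ = _ := by simp

/-- `η̃ ≤ C η`, where `C` depends only on the size of the matrix. -/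
lemma etaTildeFun_le_mul_etaFun {n m : ℕ} (A : Matrix (Fin n) (Fin (m + 1)) ℝ) :
    etaTildeFun A ≤ √(n.choose m * (m + 1)) * (m + 1) * etaFun A := by
  have hη : 0 ≤ etaFun A := Real.sqrt_nonneg _
  refine Real.iSup_le (fun s => ?_) (by positivity)
  obtain ⟨s, hs⟩ := s
  have hT : 0 ≤ ∑ K ∈ Finset.powersetCard (m + 1) Finset.univ, (minorTop A K) ^ 2 :=
    Finset.sum_nonneg fun _ _ => sq_nonneg _
  rcases (hIFun_nonneg A s).eq_or_lt with h0 | hpos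
  · simp only [← h0, div_zero]
    positivity
  have hSpos := (pow_pos hpos 2).trans_le (sq_hIFun_le_sum A s)
  unfold etaFun
  have hprod := fun (J : Finset (Fin n)) (hJ : J.card = m) (j : Fin (m + 1)) =>
    abs_minorTop_mul_abs_minorSub_le A hs hJ j
  set T := ∑ K ∈ Finset.powersetCard (m + 1) Finset.univ, (minorTop A K) ^ 2
  set S := ∑ J ∈ Finset.powersetCard m Finset.univ, ∑ j : Fin (m + 1), (minorSub A J j) ^ 2
    with hS
  have key : minorTop A s ^ 2 * S ≤ n.choose m * (m + 1) * ((m + 1) ^ 2 * hIFun A s ^ 2 * T) := by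
    calc minorTop A s ^ 2 * S = ∑ J ∈ Finset.powersetCard m Finset.univ, ∑ j : Fin (m + 1),
          minorTop A s ^ 2 * minorSub A J j ^ 2 := by simp only [hS, Finset.mul_sum]
      _ ≤ ∑ J ∈ Finset.powersetCard m (Finset.univ : Finset (Fin n)), ∑ j : Fin (m + 1),
          (m + 1 : ℝ) ^ 2 * hIFun A s ^ 2 * T := by
        refine Finset.sum_le_sum fun J hJ => Finset.sum_le_sum fun j _ => ?_
        have := pow_le_pow_left₀ (by positivity)
          (hprod J (Finset.mem_powersetCard.mp hJ).2 j) 2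
        simpa only [mul_pow, sq_abs, Real.sq_sqrt hT, mul_assoc] using this
      _ = _ := by simp [mul_assoc]
  rw [mul_assoc, ← Real.sqrt_sq (by positivity : (0 : ℝ) ≤ m + 1),
    ← Real.sqrt_mul (by positivity), ← Real.sqrt_mul (by positivity)]
  refine Real.le_sqrt_of_sq_le ?_
  rw [div_pow, sq_abs, Real.sqrt_sq (by positivity : (0 : ℝ) ≤ m + 1), div_le_iff₀ (by positivity)]
  rw [← mul_div_assoc, ← mul_div_assoc, div_mul_eq_mul_div, le_div_iff₀ hSpos]
  linarith

/-- `η ≤ C η̃`, where `C` depends only on the size of the matrix. -/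
lemma etaFun_le_mul_etaTildeFun {n m : ℕ} (A : Matrix (Fin n) (Fin (m + 1)) ℝ) :
    etaFun A ≤ √(n.choose (m + 1)) * etaTildeFun A := by
  rw [← Real.sqrt_sq (etaTildeFun_nonneg A), ← Real.sqrt_mul (by positivity)]
  refine Real.sqrt_le_sqrt ?_
  rw [Finset.sum_div]
  have hcard : (n.choose (m + 1) : ℝ) * etaTildeFun A ^ 2 =
      ∑ _K ∈ Finset.powersetCard (m + 1) (Finset.univ : Finset (Fin n)), etaTildeFun A ^ 2 := by
    simp
  rw [hcard]
  refine Finset.sum_le_sum fun K hK => ?_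
  have hle : |minorTop A K| / hIFun A K ≤ etaTildeFun A :=
    le_ciSup (f := fun s : {s : Finset (Fin n) // s.card = m + 1} =>
      |minorTop A s| / hIFun A s) (Set.finite_range _).bddAbove
      ⟨K, (Finset.mem_powersetCard.mp hK).2⟩
  refine le_trans ?_ (pow_le_pow_left₀ (div_nonneg (abs_nonneg _) (hIFun_nonneg A K)) hle 2)
  rw [div_pow, sq_abs]
  rcases (hIFun_nonneg A K).eq_or_lt with h0 | hpos
  · simp [minorTop_eq_zero_of_hIFun_eq_zero A K h0.symm]
  · exact div_le_div_of_nonneg_left (sq_nonneg _) (by positivity) (sq_hIFun_le_sum A K)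

/-- The functions `η` and `η̃` are equivalent, with constants depending only on `n` and `p`. -/
theorem stmt4 {n m : ℕ} (hnp : m + 1 ≤ n) :
    ∃ c₁ > (0:ℝ), ∃ c₂ > (0:ℝ), ∀ A : Matrix (Fin n) (Fin (m + 1)) ℝ,
      c₁ * etaTildeFun A ≤ etaFun A ∧ etaFun A ≤ c₂ * etaTildeFun A := by
  have hchoose : (0 : ℝ) < n.choose m := by
    exact_mod_cast Nat.choose_pos (by omega)
  have hchoose' : (0 : ℝ) < n.choose (m + 1) := by
    exact_mod_cast Nat.choose_pos hnp
  refine ⟨(√(n.choose m * (m + 1)) * (m + 1))⁻¹, by positivity, √(n.choose (m + 1)),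
    by positivity, fun A => ⟨?_, etaFun_le_mul_etaTildeFun A⟩⟩
  rw [inv_mul_le_iff₀ (by positivity)]
  exact etaTildeFun_le_mul_etaFun A
end

section
/- Let n ≥ p ≥ 1. The function η: M_{n,p}(ℝ) → ℝ₊ is continuous; in particular, at a matrix A at which the denominator Σ_{J,j} M_J(j)(A)² vanishes one has η(A) = 0 and η(A_k) → 0 for every sequence A_k → A. -/
/-- Deleting the `i`-th element of a finset corresponds to precomposing its increasing
enumeration with `i.succAbove`. -/
lemma orderEmbOfFin_erase {α : Type*} [LinearOrder α] {m : ℕ} {s : Finset α}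
    (h : s.card = m + 1) (i : Fin (m + 1)) (h' : (s.erase (s.orderEmbOfFin h i)).card = m) :
    (fun k => (s.erase (s.orderEmbOfFin h i)).orderEmbOfFin h' k) =
      fun k => s.orderEmbOfFin h (i.succAbove k) := by
  refine (Finset.orderEmbOfFin_unique h' (fun k => ?_) ?_).symm
  · simp [Fin.succAbove_ne]
  · exact (s.orderEmbOfFin h).strictMono.comp (Fin.strictMono_succAbove i)

/-- Cramer's rule for the rows of `A` indexed by `s`, with the adjugate expressed through
`minorSub`. -/
lemma mul_minorTop_eq_sum {n m : ℕ} (A : Matrix (Fin n) (Fin (m + 1)) ℝ) (x : Fin (m + 1) → ℝ)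
    (j : Fin (m + 1)) {s : Finset (Fin n)} (h : s.card = m + 1) :
    x j * minorTop A s = ∑ i : Fin (m + 1),
      ((-1) ^ (i + j : ℕ) * minorSub A (s.erase (s.orderEmbOfFin h i)) j) *
        (A.mulVec x) (s.orderEmbOfFin h i) := by
  set B := A.submatrix (fun i => s.orderEmbOfFin h i) id with hB
  have hx : B.adjugate.mulVec (B.mulVec x) = B.det • x := by
    rw [Matrix.mulVec_mulVec, Matrix.adjugate_mul, Matrix.smul_mulVec, Matrix.one_mulVec]
  have hxj := congrFun hx j
  rw [Pi.smul_apply, smul_eq_mul, mul_comm] at hxj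
  rw [minorTop, dif_pos h, ← hB, ← hxj]
  rw [Matrix.mulVec, dotProduct]
  refine Finset.sum_congr rfl fun i _ => ?_
  have hcard : (s.erase (s.orderEmbOfFin h i)).card = m := by
    rw [Finset.card_erase_of_mem (Finset.orderEmbOfFin_mem s h i), h, Nat.add_sub_cancel]
  rw [Matrix.adjugate_fin_succ_eq_det_submatrix, minorSub, dif_pos hcard,
    orderEmbOfFin_erase h i hcard]
  rfl

lemma sq_mul_minorTop_sq_le {n m : ℕ} (A : Matrix (Fin n) (Fin (m + 1)) ℝ)
    (x : Fin (m + 1) → ℝ) (j : Fin (m + 1)) {s : Finset (Fin n)} (h : s.card = m + 1) :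
    x j ^ 2 * minorTop A s ^ 2 ≤
      (∑ t ∈ Finset.powersetCard m Finset.univ, ∑ j : Fin (m + 1), (minorSub A t j) ^ 2) *
        ∑ i, (A.mulVec x) i ^ 2 := by
  rw [← mul_pow, mul_minorTop_eq_sum A x j h]
  refine (Finset.sum_mul_sq_le_sq_mul_sq _ _ _).trans ?_
  refine mul_le_mul ?_ ?_ (by positivity) (by positivity)
  · have hinj : Function.Injective fun i => s.erase (s.orderEmbOfFin h i) := fun a b hab =>
      (s.orderEmbOfFin h).injective
        (Finset.erase_injOn s (Finset.orderEmbOfFin_mem s h a) (Finset.orderEmbOfFin_mem s h b) hab)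
    calc _ = ∑ i, minorSub A (s.erase (s.orderEmbOfFin h i)) j ^ 2 := by
          simp [mul_pow, ← pow_mul, mul_comm _ 2]
      _ = ∑ t ∈ Finset.univ.map ⟨_, hinj⟩, minorSub A t j ^ 2 := by simp
      _ ≤ ∑ t ∈ Finset.powersetCard m Finset.univ, minorSub A t j ^ 2 := by
          refine Finset.sum_le_sum_of_subset_of_nonneg (fun t ht => ?_) fun _ _ _ => sq_nonneg _
          obtain ⟨i, -, rfl⟩ := Finset.mem_map.1 ht
          rw [Finset.mem_powersetCard_univ, Function.Embedding.coeFn_mk,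
            Finset.card_erase_of_mem (Finset.orderEmbOfFin_mem s h i), h, Nat.add_sub_cancel]
      _ ≤ _ := Finset.sum_le_sum fun t _ =>
          Finset.single_le_sum (f := fun j => minorSub A t j ^ 2) (fun _ _ => sq_nonneg _)
            (Finset.mem_univ j)
  · calc _ = ∑ i ∈ Finset.univ.map (s.orderEmbOfFin h).toEmbedding, A.mulVec x i ^ 2 :=
          (Finset.sum_map _ _ _).symm
      _ ≤ _ := Finset.sum_le_sum_of_subset_of_nonneg (Finset.subset_univ _)
          fun _ _ _ => sq_nonneg _

lemma etaFun_le_sqrt {n m : ℕ} (A : Matrix (Fin n) (Fin (m + 1)) ℝ) {x : Fin (m + 1) → ℝ}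
    {j : Fin (m + 1)} (hx : x j ≠ 0) :
    etaFun A ≤ √((n.choose (m + 1)) * (∑ i, (A.mulVec x) i ^ 2) / x j ^ 2) := by
  refine Real.sqrt_le_sqrt (div_le_of_le_mul₀ (by positivity) (by positivity) ?_)
  rw [div_mul_eq_mul_div, le_div_iff₀ (by positivity), Finset.sum_mul]
  refine (Finset.sum_le_card_nsmul _ _ _ fun s hs => ?_).trans_eq
    (b := (Finset.powersetCard (m + 1) (Finset.univ : Finset (Fin n))).card •
      ((∑ t ∈ Finset.powersetCard m Finset.univ, ∑ j : Fin (m + 1), (minorSub A t j) ^ 2) *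
        ∑ i, (A.mulVec x) i ^ 2)) ?_
  · rw [mul_comm]
    exact sq_mul_minorTop_sq_le A x j (Finset.mem_powersetCard_univ.1 hs)
  · rw [Finset.card_powersetCard, Finset.card_univ, Fintype.card_fin, nsmul_eq_mul]
    ring

/-- A matrix with trivial kernel has a nonzero maximal minor. -/
lemma exists_minorTop_ne_zero {n m : ℕ} {A : Matrix (Fin n) (Fin (m + 1)) ℝ}
    (hA : ∀ x, A.mulVec x = 0 → x = 0) :
    ∃ s : Finset (Fin n), s.card = m + 1 ∧ minorTop A s ≠ 0 := by
  obtain ⟨κ, a, ha, hspan, hli⟩ := exists_linearIndependent' ℝ A.row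
  have : Finite κ := Finite.of_injective a ha
  have := Fintype.ofFinite κ
  have hrank : A.rank = m + 1 := by
    have hinj : Function.Injective A.mulVecLin := (injective_iff_map_eq_zero _).2 hA
    rw [Matrix.rank, LinearMap.finrank_range_of_inj hinj, Module.finrank_fin_fun]
  have hκ : Fintype.card κ = m + 1 := by
    rw [← finrank_span_eq_card hli, hspan, ← Matrix.rank_eq_finrank_span_row, hrank]
  have hs : (Finset.univ.map ⟨a, ha⟩).card = m + 1 := by rw [Finset.card_map, Finset.card_univ, hκ]
  refine ⟨Finset.univ.map ⟨a, ha⟩, hs, ?_⟩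
  rw [minorTop, dif_pos hs]
  have hmem : ∀ i, ∃ k, a k = (Finset.univ.map ⟨a, ha⟩).orderEmbOfFin hs i := fun i => by
    obtain ⟨k, -, hk⟩ := Finset.mem_map.1 (Finset.orderEmbOfFin_mem _ hs i)
    exact ⟨k, hk⟩
  choose g hg using hmem
  have hginj : Function.Injective g := fun i k hik =>
    ((Finset.univ.map ⟨a, ha⟩).orderEmbOfFin hs).injective (by rw [← hg, ← hg, hik])
  have hrows := hli.comp g hginj
  rw [← isUnit_iff_ne_zero, ← Matrix.isUnit_iff_isUnit_det,
    ← Matrix.linearIndependent_rows_iff_isUnit]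
  have heq : (A.row ∘ a) ∘ g =
      (A.submatrix (fun i => (Finset.univ.map ⟨a, ha⟩).orderEmbOfFin hs i) id).row :=
    funext fun i => congrArg A (hg i)
  rw [heq] at hrows
  exact hrows

lemma continuous_minorTop {n m : ℕ} (s : Finset (Fin n)) :
    Continuous fun A : Matrix (Fin n) (Fin (m + 1)) ℝ => minorTop A s := by
  by_cases h : s.card = m + 1
  · simp only [minorTop, dif_pos h]
    exact (continuous_id.matrix_submatrix _ _).matrix_det
  · simp only [minorTop, dif_neg h, continuous_const]

lemma continuous_minorSub {n m : ℕ} (s : Finset (Fin n)) (j : Fin (m + 1)) :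
    Continuous fun A : Matrix (Fin n) (Fin (m + 1)) ℝ => minorSub A s j := by
  by_cases h : s.card = m
  · simp only [minorSub, dif_pos h]
    exact (continuous_id.matrix_submatrix _ _).matrix_det
  · simp only [minorSub, dif_neg h, continuous_const]

/-- If all the minors of order `m` vanish, then the columns of `A` are linearly dependent. -/
lemma exists_mulVec_eq_zero_of_sum_minorSub_eq_zero {n m : ℕ}
    {A : Matrix (Fin n) (Fin (m + 1)) ℝ}
    (hA : (∑ s ∈ Finset.powersetCard m Finset.univ, ∑ j : Fin (m + 1), (minorSub A s j) ^ 2) = 0) :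
    ∃ x, A.mulVec x = 0 ∧ x ≠ 0 := by
  by_contra! hker
  obtain ⟨s, hs, hne⟩ := exists_minorTop_ne_zero hker
  have hle := sq_mul_minorTop_sq_le A 1 0 hs
  rw [hA, zero_mul, Pi.one_apply, one_pow, one_mul] at hle
  exact hne (pow_eq_zero_iff two_ne_zero |>.1 (le_antisymm hle (sq_nonneg _)))

lemma etaFun_eq_zero_of_sum_minorSub_eq_zero {n m : ℕ} {A : Matrix (Fin n) (Fin (m + 1)) ℝ}
    (hA : (∑ s ∈ Finset.powersetCard m Finset.univ, ∑ j : Fin (m + 1), (minorSub A s j) ^ 2) = 0) :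
    etaFun A = 0 := by
  rw [etaFun, hA, div_zero, Real.sqrt_zero]

lemma continuous_etaFun {n m : ℕ} :
    Continuous (etaFun : Matrix (Fin n) (Fin (m + 1)) ℝ → ℝ) := by
  refine continuous_iff_continuousAt.2 fun A => ?_
  by_cases hA :
    (∑ s ∈ Finset.powersetCard m Finset.univ, ∑ j : Fin (m + 1), (minorSub A s j) ^ 2) = 0
  · obtain ⟨x, hx, hx0⟩ := exists_mulVec_eq_zero_of_sum_minorSub_eq_zero hA
    obtain ⟨j, hj⟩ := Function.ne_iff.1 hx0
    rw [ContinuousAt, etaFun_eq_zero_of_sum_minorSub_eq_zero hA]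
    refine squeeze_zero (fun B => Real.sqrt_nonneg _) (fun B => etaFun_le_sqrt B hj) ?_
    have hcont : Continuous fun B : Matrix (Fin n) (Fin (m + 1)) ℝ =>
        √((n.choose (m + 1)) * (∑ i, (B.mulVec x) i ^ 2) / x j ^ 2) := by
      have hmul : Continuous fun B : Matrix (Fin n) (Fin (m + 1)) ℝ => B.mulVec x :=
        continuous_id.matrix_mulVec continuous_const
      fun_prop
    simpa [hx] using hcont.tendsto A
  · refine ContinuousAt.sqrt (f := fun B : Matrix (Fin n) (Fin (m + 1)) ℝ => _)
      (ContinuousAt.div ?_ ?_ hA)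
    · exact (continuous_finsetSum _ fun s _ => (continuous_minorTop s).pow 2).continuousAt
    · exact (continuous_finsetSum _ fun s _ => continuous_finsetSum _ fun j _ =>
        (continuous_minorSub s j).pow 2).continuousAt

/-- `η` is continuous; in particular, at a matrix `A` where the denominator vanishes,
`η(A) = 0` and `η(A_k) → 0` for every sequence `A_k → A`. -/
theorem stmt5 {n m : ℕ} (hnp : m + 1 ≤ n) :
    Continuous (etaFun : Matrix (Fin n) (Fin (m + 1)) ℝ → ℝ) ∧
    ∀ A : Matrix (Fin n) (Fin (m + 1)) ℝ,
      (∑ s ∈ Finset.powersetCard m Finset.univ, ∑ j : Fin (m + 1), (minorSub A s j) ^ 2) = 0 →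
      etaFun A = 0 ∧
      ∀ Ak : ℕ → Matrix (Fin n) (Fin (m + 1)) ℝ,
        Filter.Tendsto Ak Filter.atTop (nhds A) →
        Filter.Tendsto (fun k => etaFun (Ak k)) Filter.atTop (nhds 0) := by
  refine ⟨continuous_etaFun, fun A hA => ?_⟩
  have h0 := etaFun_eq_zero_of_sum_minorSub_eq_zero hA
  exact ⟨h0, fun Ak hAk => h0 ▸ (continuous_etaFun.tendsto A).comp hAk⟩
end

section
/- For vectors v₁,…,v_p ∈ ℝⁿ with n ≥ p ≥ 1, let κ̃(v₁,…,v_p) = min{‖Σᵢ λᵢvᵢ‖ : λ ∈ ℝᵖ, Σᵢ λᵢ² = 1}. Then κ̃(v₁,…,v_p) ≤ κ(v₁,…,v_p) ≤ √p · κ̃(v₁,…,v_p), where κ is the Kuo distance. -/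
/-- The Kuo distance `κ(v₁,…,v_p) = min_i dist(v_i, span{v_j : j ≠ i})`. -/
noncomputable def kuo {n p : ℕ} (v : Fin p → EuclideanSpace ℝ (Fin n)) : ℝ :=
  ⨅ i : Fin p, Metric.infDist (v i)
    (Submodule.span ℝ (v '' {j | j ≠ i}) : Set (EuclideanSpace ℝ (Fin n)))

/-- `κ̃(v₁,…,v_p) = min{‖Σᵢ λᵢvᵢ‖ : Σᵢ λᵢ² = 1}`. -/
noncomputable def kuoTildeDist {n p : ℕ} (v : Fin p → EuclideanSpace ℝ (Fin n)) : ℝ :=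
  ⨅ l : {l : Fin p → ℝ // ∑ i, (l i) ^ 2 = 1}, ‖∑ i, l.1 i • v i‖

theorem nonempty_sum_sq_eq_one {p : ℕ} (hp : 1 ≤ p) :
    Nonempty {l : Fin p → ℝ // ∑ i, (l i) ^ 2 = 1} :=
  ⟨Pi.single ⟨0, hp⟩ 1, by simp [Pi.single_apply, ite_pow]⟩

theorem bddBelow_range_of_nonneg {ι : Sort*} {f : ι → ℝ} (hf : ∀ i, 0 ≤ f i) :
    BddBelow (Set.range f) :=
  ⟨0, by rintro _ ⟨i, rfl⟩; exact hf i⟩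

theorem kuoTildeDist_le_norm_sum {n p : ℕ} (v : Fin p → EuclideanSpace ℝ (Fin n))
    (a : Fin p → ℝ) (ha : 1 ≤ ∑ i, a i ^ 2) :
    kuoTildeDist v ≤ ‖∑ i, a i • v i‖ := by
  set S := ∑ i, a i ^ 2 with hS
  have hr : 1 ≤ √S := Real.one_le_sqrt.mpr ha
  have hr0 : √S ^ 2 = S := Real.sq_sqrt (by linarith)
  have hl : ∑ i, ((√S)⁻¹ * a i) ^ 2 = 1 := by
    simp_rw [mul_pow, ← Finset.mul_sum, inv_pow, hr0, ← hS]
    exact inv_mul_cancel₀ (by linarith)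
  calc kuoTildeDist v ≤ ‖∑ i, ((√S)⁻¹ * a i) • v i‖ :=
        ciInf_le (bddBelow_range_of_nonneg fun _ => norm_nonneg _)
          (⟨fun i => (√S)⁻¹ * a i, hl⟩ : {l : Fin p → ℝ // ∑ i, (l i) ^ 2 = 1})
    _ = (√S)⁻¹ * ‖∑ i, a i • v i‖ := by
        simp_rw [mul_smul, ← Finset.smul_sum, norm_smul]
        rw [Real.norm_of_nonneg (by positivity)]
    _ ≤ ‖∑ i, a i • v i‖ :=
        mul_le_of_le_one_left (norm_nonneg _) (inv_le_one_of_one_le₀ hr)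

theorem exists_sum_eq_sub_of_mem_span {n p : ℕ} (v : Fin p → EuclideanSpace ℝ (Fin n))
    (i : Fin p) {y : EuclideanSpace ℝ (Fin n)}
    (hy : y ∈ Submodule.span ℝ (v '' {j | j ≠ i})) :
    ∃ a : Fin p → ℝ, a i = 1 ∧ ∑ j, a j • v j = v i - y := by
  obtain ⟨c, hc, rfl⟩ := (Finsupp.mem_span_image_iff_linearCombination ℝ).mp hy
  have hci : c i = 0 := by
    by_contra h
    exact (Finsupp.mem_supported ℝ c).mp hc (Finsupp.mem_support_iff.mpr h) rfl
  refine ⟨fun j => (Pi.single i 1 : Fin p → ℝ) j - c j, by simp [hci], ?_⟩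
  simp [sub_smul, Finset.sum_sub_distrib, Finsupp.linearCombination_apply,
    Finsupp.sum_fintype, Pi.single_apply, ite_smul]

theorem abs_mul_infDist_span_le {n p : ℕ} (v : Fin p → EuclideanSpace ℝ (Fin n))
    (l : Fin p → ℝ) (i : Fin p) :
    |l i| * Metric.infDist (v i)
      (Submodule.span ℝ (v '' {j | j ≠ i}) : Set (EuclideanSpace ℝ (Fin n))) ≤
      ‖∑ j, l j • v j‖ := by
  rcases eq_or_ne (l i) 0 with h | h
  · simp [h]
  have hmem : -((l i)⁻¹ • ∑ j ∈ Finset.univ.erase i, l j • v j) ∈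
      Submodule.span ℝ (v '' {j | j ≠ i}) :=
    neg_mem (Submodule.smul_mem _ _ (Submodule.sum_mem _ fun j hj =>
      Submodule.smul_mem _ _ (Submodule.subset_span ⟨j, Finset.ne_of_mem_erase hj, rfl⟩)))
  calc _ ≤ |l i| * dist (v i) (-((l i)⁻¹ • ∑ j ∈ Finset.univ.erase i, l j • v j)) := by
        gcongr
        exact Metric.infDist_le_dist_of_mem hmem
    _ = ‖∑ j, l j • v j‖ := by
        rw [dist_eq_norm, sub_neg_eq_add, ← Real.norm_eq_abs, ← norm_smul, smul_add,
          smul_inv_smul₀ h, Finset.add_sum_erase _ (fun j => l j • v j) (Finset.mem_univ i)]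

theorem exists_one_le_sqrt_mul_abs {p : ℕ} (l : Fin p → ℝ) (hl : ∑ i, l i ^ 2 = 1) :
    ∃ i, 1 ≤ √p * |l i| := by
  by_contra! h
  have hp : p ≠ 0 := by rintro rfl; simp at hl
  have : Nonempty (Fin p) := ⟨⟨0, Nat.pos_of_ne_zero hp⟩⟩
  have hlt : ∑ i, (p : ℝ) * l i ^ 2 < ∑ _i : Fin p, (1 : ℝ) := by
    refine Finset.sum_lt_sum_of_nonempty Finset.univ_nonempty fun i _ => ?_
    have := pow_lt_one₀ (by positivity) (h i) two_ne_zero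
    rwa [mul_pow, sq_abs, Real.sq_sqrt p.cast_nonneg] at this
  rw [← Finset.mul_sum, hl] at hlt
  simp at hlt

/-- `κ̃ ≤ κ ≤ √p · κ̃`. -/
theorem stmt8 {n p : ℕ} (hp : 1 ≤ p) (hnp : p ≤ n)
    (v : Fin p → EuclideanSpace ℝ (Fin n)) :
    kuoTildeDist v ≤ kuo v ∧ kuo v ≤ Real.sqrt p * kuoTildeDist v := by
  have := nonempty_sum_sq_eq_one hp
  have : Nonempty (Fin p) := ⟨⟨0, hp⟩⟩
  constructor
  · refine le_ciInf fun i => (Metric.le_infDist ⟨0, Submodule.zero_mem _⟩).mpr fun y hy => ?_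
    obtain ⟨a, hai, ha⟩ := exists_sum_eq_sub_of_mem_span v i hy
    rw [dist_eq_norm, ← ha]
    refine kuoTildeDist_le_norm_sum v a ?_
    calc (1 : ℝ) = a i ^ 2 := by simp [hai]
      _ ≤ ∑ j, a j ^ 2 :=
        Finset.single_le_sum (fun j _ => sq_nonneg (a j)) (Finset.mem_univ i)
  · rw [kuoTildeDist, Real.mul_iInf_of_nonneg (Real.sqrt_nonneg _)]
    refine le_ciInf fun ⟨l, hl⟩ => ?_
    obtain ⟨i, hi⟩ := exists_one_le_sqrt_mul_abs l hl
    calc kuo v ≤ Metric.infDist (v i)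
          (Submodule.span ℝ (v '' {j | j ≠ i}) : Set (EuclideanSpace ℝ (Fin n))) :=
          ciInf_le (bddBelow_range_of_nonneg fun _ => Metric.infDist_nonneg) i
      _ ≤ √p * |l i| * Metric.infDist (v i)
          (Submodule.span ℝ (v '' {j | j ≠ i}) : Set (EuclideanSpace ℝ (Fin n))) :=
          le_mul_of_one_le_left Metric.infDist_nonneg hi
      _ ≤ √p * ‖∑ j, l j • v j‖ := by
          rw [mul_assoc]
          gcongr
          exact abs_mul_infDist_span_le v l i
end

section
/- Let r be a positive integer, let Σ be a closed subset of ℝⁿ with 0 ∈ Σ, and let f: (ℝⁿ,0) → (ℝᵖ,0) be a C^{r+1} map-germ with n ≥ p. Then f satisfies condition (K̃_Σ^δ) if and only if for every C^{r+1} map-germ g with j^r g(Σ;0) = j^r f(Σ;0) there exist δ, C, α > 0 (depending on g) such that d(x,Σ)·‖dg*(x)y‖ + ‖g(x)‖ ≥ C·d(x,Σ)^{r+1−δ} for all x with ‖x‖ < α and all y ∈ 𝕊^{p−1}. -/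
/-- The gradient of the `i`-th component of `f` at `x`, i.e. `df*(x)` applied to the
`i`-th standard basis vector. -/
noncomputable def grad {n p : ℕ} (f : EuclideanSpace ℝ (Fin n) → EuclideanSpace ℝ (Fin p))
    (x : EuclideanSpace ℝ (Fin n)) (i : Fin p) : EuclideanSpace ℝ (Fin n) :=
  ContinuousLinearMap.adjoint (fderiv ℝ f x) (EuclideanSpace.single i 1)

/-- `κ(df(x)) = κ(grad f₁(x),…,grad f_p(x))`. -/
noncomputable def kuoD {n p : ℕ} (f : EuclideanSpace ℝ (Fin n) → EuclideanSpace ℝ (Fin p))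
    (x : EuclideanSpace ℝ (Fin n)) : ℝ :=
  kuo (grad f x)

/-- `j^r f(Σ;0) = j^r g(Σ;0)`: all partial derivatives of order ≤ r of `f` and `g`
coincide on `Σ ∩ U` for some neighbourhood `U` of the origin. -/
def jetEqual {n p : ℕ} (r : ℕ) (S : Set (EuclideanSpace ℝ (Fin n)))
    (f g : EuclideanSpace ℝ (Fin n) → EuclideanSpace ℝ (Fin p)) : Prop :=
  ∃ U ∈ nhds (0 : EuclideanSpace ℝ (Fin n)), ∀ z ∈ S ∩ U, ∀ k : ℕ, k ≤ r →
    iteratedFDeriv ℝ k f z = iteratedFDeriv ℝ k g z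

/-- Condition `(K̃_Σ^δ)`. -/
def KuoTildeDeltaRel {n p : ℕ} (r : ℕ) (S : Set (EuclideanSpace ℝ (Fin n)))
    (f : EuclideanSpace ℝ (Fin n) → EuclideanSpace ℝ (Fin p)) : Prop :=
  ∀ g : EuclideanSpace ℝ (Fin n) → EuclideanSpace ℝ (Fin p),
    ContDiff ℝ (r + 1) g → g 0 = 0 → jetEqual r S f g →
    ∃ δ > (0:ℝ), ∃ C > (0:ℝ), ∃ α > (0:ℝ), ∀ x : EuclideanSpace ℝ (Fin n), ‖x‖ < α →
      Metric.infDist x S * kuoD f x + ‖g x‖ ≥ C * Metric.infDist x S ^ ((r : ℝ) + 1 - δ)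

/-- A map whose derivatives of order `< m` vanish at `z` is `O(‖x - z‖ ^ m)` on a convex set on
which its `m`-th derivative is bounded. -/
theorem norm_le_of_iteratedFDeriv_eq_zero {E : Type} [NormedAddCommGroup E] [NormedSpace ℝ E]
    {z : E} {M : ℝ} (m : ℕ) :
    ∀ {G : Type} [NormedAddCommGroup G] [NormedSpace ℝ G] {F : E → G} {s : Set E},
      ContDiff ℝ m F → Convex ℝ s → z ∈ s →
      (∀ k < m, iteratedFDeriv ℝ k F z = 0) →
      (∀ w ∈ s, ‖iteratedFDeriv ℝ m F w‖ ≤ M) →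
      ∀ x ∈ s, ‖F x‖ ≤ M * ‖x - z‖ ^ m := by
  induction m with
  | zero =>
    intro G _ _ F s _ _ _ _ hM x hx
    simpa using hM x hx
  | succ m ih =>
    intro G _ _ F s hF hs hz h0 hM x hx
    have hF' : ContDiff ℝ m (fderiv ℝ F) := hF.fderiv_right (by norm_cast)
    have hFz : F z = 0 := by
      have h := congrArg norm (h0 0 (Nat.succ_pos m))
      simpa using h
    have hM0 : 0 ≤ M := (norm_nonneg _).trans (hM z hz)
    have hder : ∀ w ∈ s, ‖fderiv ℝ F w‖ ≤ M * ‖w - z‖ ^ m :=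
      ih hF' hs hz
        (fun k hk => by
          rw [← norm_eq_zero, norm_iteratedFDeriv_fderiv, h0 (k + 1) (by omega), norm_zero])
        (fun w hw => by rw [norm_iteratedFDeriv_fderiv]; exact hM w hw)
    have hmv := (hs.inter (convex_closedBall z ‖x - z‖)).norm_image_sub_le_of_norm_fderiv_le
      (f := F) (𝕜 := ℝ) (C := M * ‖x - z‖ ^ m) (x := z) (y := x)
      (fun w _ => (hF.differentiable (by simp)) w)
      (fun w hw => (hder w hw.1).trans (by
        have := mem_closedBall_iff_norm.1 hw.2
        gcongr))
      ⟨hz, by simp⟩ ⟨hx, by simp [dist_eq_norm]⟩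
    rw [hFz, sub_zero] at hmv
    rw [pow_succ, ← mul_assoc]
    exact hmv

/-- If the `r`-jets of `f` and `g` agree on `S` near `0`, their differentials differ by
`O(d(x, S) ^ r)`. -/
theorem jetEqual.exists_norm_fderiv_sub_le {n p r : ℕ} {S : Set (EuclideanSpace ℝ (Fin n))}
    (hS : IsClosed S) (h0S : (0 : EuclideanSpace ℝ (Fin n)) ∈ S)
    {f g : EuclideanSpace ℝ (Fin n) → EuclideanSpace ℝ (Fin p)}
    (hf : ContDiff ℝ (r + 1) f) (hg : ContDiff ℝ (r + 1) g) (hfg : jetEqual r S f g) :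
    ∃ K > (0 : ℝ), ∃ α > (0 : ℝ), ∀ x : EuclideanSpace ℝ (Fin n), ‖x‖ < α →
      ‖fderiv ℝ f x - fderiv ℝ g x‖ ≤ K * Metric.infDist x S ^ r := by
  obtain ⟨U, hU, hjet⟩ := hfg
  have hh : ContDiff ℝ (r + 1) (f - g) := hf.sub hg
  have hcont : Continuous (iteratedFDeriv ℝ (r + 1) (f - g)) :=
    hh.continuous_iteratedFDeriv (by norm_cast)
  have hbound : ∀ᶠ x in nhds (0 : EuclideanSpace ℝ (Fin n)),
      ‖iteratedFDeriv ℝ (r + 1) (f - g) x‖ < ‖iteratedFDeriv ℝ (r + 1) (f - g) 0‖ + 1 :=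
    hcont.norm.continuousAt.eventually_lt continuousAt_const (by simp)
  obtain ⟨ρ, hρ, hball⟩ := Metric.eventually_nhds_iff_ball.1 (hbound.and hU)
  refine ⟨‖iteratedFDeriv ℝ (r + 1) (f - g) 0‖ + 1, by positivity, ρ / 2, by positivity,
    fun x hx => ?_⟩
  obtain ⟨z, hzS, hz⟩ := hS.exists_infDist_eq_dist ⟨0, h0S⟩ x
  have hdx : Metric.infDist x S ≤ ‖x‖ := by
    simpa using Metric.infDist_le_dist_of_mem (x := x) h0S
  have hxz : ‖x - z‖ = Metric.infDist x S := by rw [hz, dist_eq_norm]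
  have hzρ : z ∈ Metric.ball (0 : EuclideanSpace ℝ (Fin n)) ρ := by
    rw [mem_ball_zero_iff]
    have h1 : ‖z‖ ≤ ‖x‖ + ‖x - z‖ := by
      have := norm_sub_le x (x - z)
      simpa using this
    linarith
  have hxρ : x ∈ Metric.ball (0 : EuclideanSpace ℝ (Fin n)) ρ := by
    rw [mem_ball_zero_iff]; linarith
  have key := norm_le_of_iteratedFDeriv_eq_zero (z := z)
    (M := ‖iteratedFDeriv ℝ (r + 1) (f - g) 0‖ + 1) r (F := fderiv ℝ (f - g))
    (hh.fderiv_right le_rfl) (convex_ball 0 ρ) hzρ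
    (fun k hk => by
      rw [← norm_eq_zero, norm_iteratedFDeriv_fderiv,
        iteratedFDeriv_sub_apply
          (hf.contDiffAt.of_le (by exact_mod_cast (by omega : k + 1 ≤ r + 1)))
          (hg.contDiffAt.of_le (by exact_mod_cast (by omega : k + 1 ≤ r + 1))),
        hjet z ⟨hzS, (hball z hzρ).2⟩ (k + 1) hk, sub_self, norm_zero])
    (fun w hw => by rw [norm_iteratedFDeriv_fderiv]; exact (hball w hw).1.le) x hxρ
  rw [fderiv_sub (hf.differentiable (by simp) x) (hg.differentiable (by simp) x), hxz] at key
  exact key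

/-- Near `d = 0` a term of order `d ^ (r + 1)` is absorbed by `d ^ (r + 1 - δ)`. -/
theorem exists_absorb_rpow (r : ℕ) {δ C : ℝ} (hδ : 0 < δ) (hC : 0 < C) (K : ℝ) :
    ∃ δ' > (0 : ℝ), ∃ α > (0 : ℝ), ∀ d : ℝ, 0 ≤ d → d < α →
      C / 2 * d ^ ((r : ℝ) + 1 - δ') + K * d ^ (r + 1) ≤ C * d ^ ((r : ℝ) + 1 - δ) := by
  set e := min δ (1 / 2) with he
  have he0 : 0 < e := lt_min hδ (by norm_num)
  have he1 : e ≤ 1 / 2 := min_le_right _ _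
  have hlim : ∀ᶠ d : ℝ in nhds 0, K * d ^ e < C / 2 := by
    have hc : ContinuousAt (fun d : ℝ => K * d ^ e) 0 :=
      continuousAt_const.mul (Real.continuousAt_rpow_const _ _ (Or.inr he0.le))
    exact hc.eventually_lt continuousAt_const (by simp [Real.zero_rpow he0.ne', hC])
  obtain ⟨β, hβ, hball⟩ := Metric.eventually_nhds_iff.1 hlim
  refine ⟨e, he0, min β 1, lt_min hβ one_pos, fun d hd hdα => ?_⟩
  have hr0 : (0 : ℝ) ≤ r := r.cast_nonneg
  rcases hd.eq_or_lt with rfl | hd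
  · rw [Real.zero_rpow (by linarith : (r : ℝ) + 1 - e ≠ 0)]
    simpa using mul_nonneg hC.le (Real.rpow_nonneg le_rfl ((r : ℝ) + 1 - δ))
  have hs : K * d ^ e < C / 2 := hball (by
    rw [dist_zero_right, Real.norm_of_nonneg hd.le]; exact hdα.trans_le (min_le_left _ _))
  have hpow : d ^ (r + 1) = d ^ e * d ^ ((r : ℝ) + 1 - e) := by
    rw [← Real.rpow_add hd, ← Real.rpow_natCast]
    congr 1
    push_cast
    ring
  have hle : d ^ ((r : ℝ) + 1 - e) ≤ d ^ ((r : ℝ) + 1 - δ) :=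
    Real.rpow_le_rpow_of_exponent_ge hd (hdα.le.trans (min_le_right _ _))
      (by linarith [min_le_left δ (1 / 2)])
  have hP : 0 ≤ d ^ ((r : ℝ) + 1 - e) := Real.rpow_nonneg hd.le _
  rw [hpow]
  nlinarith [mul_le_mul_of_nonneg_right hs.le hP, mul_le_mul_of_nonneg_left hle hC.le]

theorem adjoint_fderiv_eq_sum_grad {n p : ℕ}
    (f : EuclideanSpace ℝ (Fin n) → EuclideanSpace ℝ (Fin p)) (x : EuclideanSpace ℝ (Fin n))
    (y : EuclideanSpace ℝ (Fin p)) :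
    ContinuousLinearMap.adjoint (fderiv ℝ f x) y = ∑ i, y i • grad f x i := by
  have hy : y = ∑ i, y i • EuclideanSpace.single i (1 : ℝ) := by
    ext j
    simp [Finset.sum_apply, Pi.single_apply]
  conv_lhs => rw [hy]
  simp [grad, map_sum]

/-- The Kuo distance bounds linear combinations with unit coefficient vector from below. -/
theorem kuo_le_card_mul_norm_sum {n p : ℕ} (hp : 1 ≤ p) (v : Fin p → EuclideanSpace ℝ (Fin n))
    (y : EuclideanSpace ℝ (Fin p)) (hy : ‖y‖ = 1) : kuo v ≤ p * ‖∑ i, y i • v i‖ := by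
  have hp0 : (0 : ℝ) < p := by exact_mod_cast hp
  obtain ⟨i, hi⟩ : ∃ i, 1 ≤ p * |y i| := by
    by_contra! h
    have hlt : ∀ i, y i ^ 2 < 1 / p := fun i => by
      have h1 : |y i| < 1 / p := by rw [lt_div_iff₀ hp0]; linarith [h i]
      have h2 : (1 : ℝ) / p ≤ 1 := by
        rw [div_le_one hp0]; exact_mod_cast hp
      rw [← sq_abs]
      nlinarith [abs_nonneg (y i)]
    have hsum : ∑ i, y i ^ 2 = 1 := by
      have := EuclideanSpace.norm_sq_eq y
      rw [hy] at this
      simpa using this.symm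
    have : ∑ i, y i ^ 2 < ∑ _i : Fin p, (1 : ℝ) / p :=
      Finset.sum_lt_sum_of_nonempty ⟨⟨0, hp⟩, Finset.mem_univ _⟩ fun i _ => hlt i
    simp [hsum, hp0.ne'] at this
  have hyi : y i ≠ 0 := by
    rintro h
    rw [h] at hi
    norm_num at hi
  set w := -∑ j ∈ Finset.univ.erase i, (y j / y i) • v j with hw
  have hwmem : w ∈ Submodule.span ℝ (v '' {j | j ≠ i}) := by
    refine Submodule.neg_mem _ (Submodule.sum_mem _ fun j hj => Submodule.smul_mem _ _ ?_)
    exact Submodule.subset_span ⟨j, Finset.ne_of_mem_erase hj, rfl⟩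
  have hsum : ∑ j, y j • v j = y i • (v i - w) := by
    rw [← Finset.add_sum_erase _ _ (Finset.mem_univ i), hw, sub_neg_eq_add, smul_add,
      Finset.smul_sum]
    congr 1
    refine Finset.sum_congr rfl fun j _ => ?_
    rw [smul_smul, mul_div_cancel₀ _ hyi]
  calc kuo v ≤ Metric.infDist (v i)
        (Submodule.span ℝ (v '' {j | j ≠ i}) : Set (EuclideanSpace ℝ (Fin n))) :=
        ciInf_le (Set.finite_range _).bddBelow i
    _ ≤ ‖v i - w‖ := by
        rw [← dist_eq_norm]; exact Metric.infDist_le_dist_of_mem hwmem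
    _ ≤ (p * |y i|) * ‖v i - w‖ := le_mul_of_one_le_left (norm_nonneg _) hi
    _ = p * ‖∑ j, y j • v j‖ := by rw [hsum, norm_smul, Real.norm_eq_abs, mul_assoc]

/-- A lower bound for all unit linear combinations is a lower bound for the Kuo distance. -/
theorem le_kuo {n p : ℕ} (hp : 1 ≤ p) (v : Fin p → EuclideanSpace ℝ (Fin n)) {m : ℝ}
    (h : ∀ y : EuclideanSpace ℝ (Fin p), ‖y‖ = 1 → m ≤ ‖∑ i, y i • v i‖) : m ≤ kuo v := by
  have : Nonempty (Fin p) := ⟨⟨0, hp⟩⟩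
  refine le_ciInf fun i => (Metric.le_infDist ⟨0, Submodule.zero_mem _⟩).2 fun w hw => ?_
  obtain ⟨a, ha, haw⟩ : ∃ a : Fin p → ℝ, a i = 0 ∧ ∑ j, a j • v j = w := by
    refine Submodule.span_induction (p := fun w _ => ∃ a : Fin p → ℝ, a i = 0 ∧
      ∑ j, a j • v j = w) ?_ ⟨0, rfl, by simp⟩ ?_ ?_ hw
    · rintro _ ⟨j, hj, rfl⟩
      exact ⟨Pi.single j 1, Pi.single_eq_of_ne (Ne.symm hj) _, by simp [Pi.single_apply]⟩
    · rintro _ _ _ _ ⟨a, ha, rfl⟩ ⟨b, hb, rfl⟩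
      exact ⟨a + b, by simp [ha, hb], by simp [add_smul, Finset.sum_add_distrib]⟩
    · rintro c _ _ ⟨a, ha, rfl⟩
      exact ⟨c • a, by simp [ha], by simp [mul_smul, Finset.smul_sum]⟩
  set u : EuclideanSpace ℝ (Fin p) := EuclideanSpace.single i 1 - WithLp.toLp 2 a with hu
  have hu1 : 1 ≤ ‖u‖ := by
    have := PiLp.norm_apply_le u i
    simpa [hu, ha] using this
  have hu0 : 0 < ‖u‖ := one_pos.trans_le hu1
  have hsum : ∑ j, u j • v j = v i - w := by
    simp [hu, sub_smul, Finset.sum_sub_distrib, haw]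
  have hm := h (‖u‖⁻¹ • u) (by rw [norm_smul, norm_inv, norm_norm, inv_mul_cancel₀ hu0.ne'])
  have hsm : ∑ j, (‖u‖⁻¹ • u) j • v j = ‖u‖⁻¹ • (v i - w) := by
    rw [← hsum, Finset.smul_sum]
    exact Finset.sum_congr rfl fun j _ => by rw [PiLp.smul_apply, smul_eq_mul, mul_smul]
  rw [hsm, norm_smul, norm_inv, norm_norm] at hm
  rw [dist_eq_norm]
  exact hm.trans (mul_le_of_le_one_left (norm_nonneg _) (inv_le_one_of_one_le₀ hu1))

theorem norm_adjoint_apply_le_add {E F : Type*} [NormedAddCommGroup E] [InnerProductSpace ℝ E]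
    [CompleteSpace E] [NormedAddCommGroup F] [InnerProductSpace ℝ F] [CompleteSpace F]
    (A B : E →L[ℝ] F) {y : F} (hy : ‖y‖ = 1) :
    ‖ContinuousLinearMap.adjoint A y‖ ≤ ‖ContinuousLinearMap.adjoint B y‖ + ‖A - B‖ := by
  have h1 : ‖ContinuousLinearMap.adjoint (A - B) y‖ ≤ ‖A - B‖ := by
    have := (ContinuousLinearMap.adjoint (A - B)).le_opNorm y
    rwa [hy, mul_one, LinearIsometryEquiv.norm_map] at this
  have h2 : ContinuousLinearMap.adjoint A y =
      ContinuousLinearMap.adjoint B y + ContinuousLinearMap.adjoint (A - B) y := by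
    rw [map_sub]
    simp
  rw [h2]
  exact (norm_add_le _ _).trans (by gcongr)

/-- `(K̃_Σ^δ)` is equivalent to the uniform adjoint inequality for `dg*`. -/
theorem stmt10 {n p r : ℕ} (hr : 1 ≤ r) (hp : 1 ≤ p) (hnp : p ≤ n)
    (S : Set (EuclideanSpace ℝ (Fin n)))
    (hS : IsClosed S) (h0S : (0 : EuclideanSpace ℝ (Fin n)) ∈ S)
    (f : EuclideanSpace ℝ (Fin n) → EuclideanSpace ℝ (Fin p))
    (hf : ContDiff ℝ (r + 1) f) (hf0 : f 0 = 0) :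
    KuoTildeDeltaRel r S f ↔
      ∀ g : EuclideanSpace ℝ (Fin n) → EuclideanSpace ℝ (Fin p),
        ContDiff ℝ (r + 1) g → g 0 = 0 → jetEqual r S f g →
        ∃ δ > (0:ℝ), ∃ C > (0:ℝ), ∃ α > (0:ℝ), ∀ x : EuclideanSpace ℝ (Fin n),
          ∀ y : EuclideanSpace ℝ (Fin p), ‖x‖ < α → ‖y‖ = 1 →
          Metric.infDist x S * ‖ContinuousLinearMap.adjoint (fderiv ℝ g x) y‖ + ‖g x‖ ≥
            C * Metric.infDist x S ^ ((r : ℝ) + 1 - δ) := by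
  have hp0 : (0 : ℝ) < p := by exact_mod_cast hp
  have hp1 : (1 : ℝ) ≤ p := by exact_mod_cast hp
  have hdist : ∀ x : EuclideanSpace ℝ (Fin n), Metric.infDist x S ≤ ‖x‖ := fun x => by
    simpa using Metric.infDist_le_dist_of_mem (x := x) h0S
  constructor
  · intro h g hg hg0 hfg
    obtain ⟨δ, hδ, C, hC, α, hα, hin⟩ := h g hg hg0 hfg
    obtain ⟨K, -, β, hβ, hK⟩ := hfg.exists_norm_fderiv_sub_le hS h0S hf hg
    obtain ⟨δ', hδ', γ, hγ, habs⟩ := exists_absorb_rpow r hδ hC (p * K)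
    refine ⟨δ', hδ', C / 2 / p, by positivity, min α (min β γ),
      lt_min hα (lt_min hβ hγ), fun x y hx hy => ?_⟩
    obtain ⟨hxα, hxβ, hxγ⟩ : ‖x‖ < α ∧ ‖x‖ < β ∧ ‖x‖ < γ := by simpa using hx
    have h1 := hin x hxα
    have h2 := hK x hxβ
    have hd : 0 ≤ Metric.infDist x S := Metric.infDist_nonneg
    have h3 := habs _ hd ((hdist x).trans_lt hxγ)
    have h4 : kuoD f x ≤ p * ‖ContinuousLinearMap.adjoint (fderiv ℝ f x) y‖ := by
      rw [adjoint_fderiv_eq_sum_grad]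
      exact kuo_le_card_mul_norm_sum hp _ y hy
    have h5 := norm_adjoint_apply_le_add (fderiv ℝ f x) (fderiv ℝ g x) hy
    set d := Metric.infDist x S
    have h6 : d * kuoD f x ≤
        d * (p * (‖ContinuousLinearMap.adjoint (fderiv ℝ g x) y‖ + K * d ^ r)) := by
      refine mul_le_mul_of_nonneg_left (h4.trans ?_) hd
      gcongr
      linarith
    have h7 : ‖g x‖ ≤ p * ‖g x‖ := le_mul_of_one_le_left (norm_nonneg _) hp1
    rw [ge_iff_le, div_mul_eq_mul_div, div_le_iff₀ hp0]
    rw [pow_succ] at h3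
    linarith
  · intro h g hg hg0 hfg
    obtain ⟨δ, hδ, C, hC, α, hα, hin⟩ := h g hg hg0 hfg
    obtain ⟨K, -, β, hβ, hK⟩ := hfg.exists_norm_fderiv_sub_le hS h0S hf hg
    obtain ⟨δ', hδ', γ, hγ, habs⟩ := exists_absorb_rpow r hδ hC K
    refine ⟨δ', hδ', C / 2, by positivity, min α (min β γ),
      lt_min hα (lt_min hβ hγ), fun x hx => ?_⟩
    obtain ⟨hxα, hxβ, hxγ⟩ : ‖x‖ < α ∧ ‖x‖ < β ∧ ‖x‖ < γ := by simpa using hx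
    have h2 := hK x hxβ
    have hd : 0 ≤ Metric.infDist x S := Metric.infDist_nonneg
    have h3 := habs _ hd ((hdist x).trans_lt hxγ)
    have h4 : ∀ y : EuclideanSpace ℝ (Fin p), ‖y‖ = 1 →
        C / 2 * Metric.infDist x S ^ ((r : ℝ) + 1 - δ') - ‖g x‖ ≤
          Metric.infDist x S * ‖∑ i, y i • grad f x i‖ := by
      intro y hy
      rw [← adjoint_fderiv_eq_sum_grad]
      have h1 := hin x y hxα hy
      have h5 := norm_adjoint_apply_le_add (fderiv ℝ g x) (fderiv ℝ f x) hy
      rw [norm_sub_rev] at h5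
      have h6 := mul_le_mul_of_nonneg_left (h5.trans (add_le_add_right h2 _)) hd
      rw [pow_succ] at h3
      linarith
    suffices C / 2 * Metric.infDist x S ^ ((r : ℝ) + 1 - δ') - ‖g x‖ ≤
        Metric.infDist x S * kuoD f x by linarith
    rcases hd.eq_or_lt with hd0 | hd0
    · have h5 := h4 (EuclideanSpace.single ⟨0, hp⟩ 1) (by simp)
      rw [← hd0, zero_mul] at h5 ⊢
      exact h5
    · rw [← div_le_iff₀' hd0]
      exact le_kuo hp _ fun y hy => (div_le_iff₀' hd0).2 (h4 y hy)
end

section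
/- Let r be a positive integer, let Σ be a closed subset of ℝⁿ with 0 ∈ Σ, and let f: (ℝⁿ,0) → (ℝᵖ,0) be a C^{r+1} map-germ with n ≥ p satisfying condition (KZ_Σ). Then for every C^{r+1} map-germ g with j^r g(Σ;0) = j^r f(Σ;0), the quotient (d(x,Σ)·‖df*(x)y‖ + ‖g(x)‖)/d(x,Σ)^{r+1} also tends to ∞ uniformly in y ∈ 𝕊^{p−1} as d(x,Σ) → 0, d(x,Σ) ≠ 0, in a neighbourhood of 0: for every M > 0 there exists ε > 0 such that d(x,Σ)·‖df*(x)y‖ + ‖g(x)‖ ≥ M·d(x,Σ)^{r+1} whenever ‖x‖ < ε, 0 < d(x,Σ) < ε, and y ∈ 𝕊^{p−1}. -/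
/-- Condition `(KZ_Σ)`: the quotient `(d(x,Σ)·‖df*(x)y‖ + ‖f(x)‖)/d(x,Σ)^{r+1}` tends to `∞`
uniformly in `y ∈ 𝕊^{p-1}` as `d(x,Σ) → 0`, `d(x,Σ) ≠ 0`, near the origin. -/
def KZRel {n p : ℕ} (r : ℕ) (S : Set (EuclideanSpace ℝ (Fin n)))
    (f : EuclideanSpace ℝ (Fin n) → EuclideanSpace ℝ (Fin p)) : Prop :=
  ∀ M > (0:ℝ), ∃ ε > (0:ℝ), ∀ x : EuclideanSpace ℝ (Fin n), ∀ y : EuclideanSpace ℝ (Fin p),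
    ‖x‖ < ε → 0 < Metric.infDist x S → Metric.infDist x S < ε → ‖y‖ = 1 →
    Metric.infDist x S * ‖ContinuousLinearMap.adjoint (fderiv ℝ f x) y‖ + ‖f x‖ ≥
      M * Metric.infDist x S ^ (r + 1)

/-- Taylor estimate at a zero of order `m`: if the derivatives of order `< m` of a `C^m` map vanish
at `z` and the `m`-th one is bounded by `C` on a ball around `z`, then the derivative of order `k`
is bounded by `C * ‖x - z‖ ^ j` there, where `k + j = m`. -/
theorem norm_iteratedFDeriv_le_mul_pow_of_eq_zero {E F : Type*}
    [NormedAddCommGroup E] [NormedSpace ℝ E] [NormedAddCommGroup F] [NormedSpace ℝ F]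
    {h : E → F} {m : ℕ} (hh : ContDiff ℝ m h) {z : E} {ρ C : ℝ} (hC : 0 ≤ C)
    (hz : ∀ k < m, iteratedFDeriv ℝ k h z = 0)
    (hbd : ∀ x ∈ Metric.closedBall z ρ, ‖iteratedFDeriv ℝ m h x‖ ≤ C) (j : ℕ) :
    ∀ k : ℕ, k + j = m → ∀ x ∈ Metric.closedBall z ρ,
      ‖iteratedFDeriv ℝ k h x‖ ≤ C * ‖x - z‖ ^ j := by
  induction j with
  | zero =>
    rintro k rfl x hx
    simpa using hbd x hx
  | succ j ih =>
    intro k hk x hx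
    have hx' : ‖x - z‖ ≤ ρ := by simpa [dist_eq_norm] using hx
    have hdiff : Differentiable ℝ (iteratedFDeriv ℝ k h) :=
      hh.differentiable_iteratedFDeriv (by exact_mod_cast (by omega : k < m))
    have hderiv : ∀ w ∈ Metric.closedBall z ‖x - z‖,
        ‖fderiv ℝ (iteratedFDeriv ℝ k h) w‖ ≤ C * ‖x - z‖ ^ j := by
      intro w hw
      have hw' : ‖w - z‖ ≤ ‖x - z‖ := by simpa [dist_eq_norm] using hw
      rw [norm_fderiv_iteratedFDeriv]
      refine (ih (k + 1) (by omega) w ?_).trans (by gcongr)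
      simpa [dist_eq_norm] using hw'.trans hx'
    have hmvt := (convex_closedBall z ‖x - z‖).norm_image_sub_le_of_norm_fderiv_le
      (fun w _ => hdiff w) hderiv (Metric.mem_closedBall_self (norm_nonneg _))
      (by simp [dist_eq_norm] : x ∈ Metric.closedBall z ‖x - z‖)
    rw [hz k (by omega), sub_zero] at hmvt
    rwa [pow_succ, ← mul_assoc]

/-- If two `C^{r+1}` maps have the same `r`-jet along a closed set containing the origin, then near
the origin they differ by at most a constant times the `(r+1)`-st power of the distance. -/
theorem jetEqual.exists_norm_sub_le {n p r : ℕ} {S : Set (EuclideanSpace ℝ (Fin n))}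
    (hS : IsClosed S) (h0S : (0 : EuclideanSpace ℝ (Fin n)) ∈ S)
    {f g : EuclideanSpace ℝ (Fin n) → EuclideanSpace ℝ (Fin p)}
    (hf : ContDiff ℝ (r + 1) f) (hg : ContDiff ℝ (r + 1) g) (hfg : jetEqual r S f g) :
    ∃ C > (0 : ℝ), ∃ δ > (0 : ℝ), ∀ x : EuclideanSpace ℝ (Fin n), ‖x‖ < δ →
      ‖f x - g x‖ ≤ C * Metric.infDist x S ^ (r + 1) := by
  obtain ⟨U, hU, hjet⟩ := hfg
  have hh : ContDiff ℝ ((r + 1 : ℕ) : WithTop ℕ∞) (f - g) := by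
    exact_mod_cast hf.sub hg
  have hcont : Continuous fun x => ‖iteratedFDeriv ℝ (r + 1) (f - g) x‖ :=
    (hh.continuous_iteratedFDeriv le_rfl).norm
  have hev := hcont.continuousAt.eventually_lt_const
    (lt_add_one ‖iteratedFDeriv ℝ (r + 1) (f - g) 0‖)
  obtain ⟨η, hη, hball⟩ := Metric.mem_nhds_iff.1 (Filter.inter_mem hU hev)
  refine ⟨‖iteratedFDeriv ℝ (r + 1) (f - g) 0‖ + 1, by positivity, η / 3, by positivity, ?_⟩
  intro x hx
  obtain ⟨z, hzS, hz⟩ := hS.exists_infDist_eq_dist ⟨0, h0S⟩ x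
  have hxz : ‖x - z‖ ≤ ‖x‖ := by
    simpa [hz, dist_eq_norm] using Metric.infDist_le_dist_of_mem (x := x) h0S
  have hsub : ∀ w ∈ Metric.closedBall z ‖x - z‖, w ∈ Metric.ball (0 : EuclideanSpace ℝ (Fin n)) η := by
    intro w hw
    have hw' : ‖w - z‖ ≤ ‖x - z‖ := by simpa [dist_eq_norm] using hw
    have hwx : ‖w‖ ≤ ‖w - z‖ + ‖x - z‖ + ‖x‖ := by
      calc ‖w‖ = ‖(w - z) - (x - z) + x‖ := by congr 1; abel
        _ ≤ ‖(w - z) - (x - z)‖ + ‖x‖ := norm_add_le _ _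
        _ ≤ _ := by gcongr; exact norm_sub_le _ _
    rw [mem_ball_zero_iff]
    linarith
  have hzU : z ∈ U := (hball (hsub z (Metric.mem_closedBall_self (norm_nonneg _)))).1
  have hzero : ∀ k < r + 1, iteratedFDeriv ℝ k (f - g) z = 0 := by
    intro k hk
    have hk' : (k : WithTop ℕ∞) ≤ r + 1 := by exact_mod_cast hk.le
    rw [iteratedFDeriv_sub_apply (hf.of_le hk').contDiffAt (hg.of_le hk').contDiffAt,
      hjet z ⟨hzS, hzU⟩ k (by omega), sub_self]
  have key := norm_iteratedFDeriv_le_mul_pow_of_eq_zero hh (by positivity) hzero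
    (fun w hw => (hball (hsub w hw)).2.le) (r + 1) 0 (zero_add _) x (by simp [dist_eq_norm])
  simpa [norm_iteratedFDeriv_zero, hz, dist_eq_norm] using key

/-- If `f` satisfies `(KZ_Σ)` then the same divergence holds with `‖g(x)‖` in place of
`‖f(x)‖` for any `C^{r+1}` realisation `g` of the relative jet of `f`. -/
theorem stmt14 {n p r : ℕ} (hr : 1 ≤ r) (hnp : p ≤ n)
    (S : Set (EuclideanSpace ℝ (Fin n)))
    (hS : IsClosed S) (h0S : (0 : EuclideanSpace ℝ (Fin n)) ∈ S)
    (f : EuclideanSpace ℝ (Fin n) → EuclideanSpace ℝ (Fin p))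
    (hf : ContDiff ℝ (r + 1) f) (hf0 : f 0 = 0)
    (hKZ : KZRel r S f) :
    ∀ g : EuclideanSpace ℝ (Fin n) → EuclideanSpace ℝ (Fin p),
      ContDiff ℝ (r + 1) g → g 0 = 0 → jetEqual r S f g →
      ∀ M > (0:ℝ), ∃ ε > (0:ℝ), ∀ x : EuclideanSpace ℝ (Fin n),
        ∀ y : EuclideanSpace ℝ (Fin p),
        ‖x‖ < ε → 0 < Metric.infDist x S → Metric.infDist x S < ε → ‖y‖ = 1 →
        Metric.infDist x S * ‖ContinuousLinearMap.adjoint (fderiv ℝ f x) y‖ + ‖g x‖ ≥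
          M * Metric.infDist x S ^ (r + 1) := by
  intro g hg _ hfg M hM
  obtain ⟨C, hC, δ, hδ, hle⟩ := hfg.exists_norm_sub_le hS h0S hf hg
  obtain ⟨ε, hε, hKZ⟩ := hKZ (M + C) (by positivity)
  refine ⟨min ε δ, lt_min hε hδ, fun x y hx hd hdε hy => ?_⟩
  have h₁ := hKZ x y (hx.trans_le (min_le_left _ _)) hd (hdε.trans_le (min_le_left _ _)) hy
  have h₂ := hle x (hx.trans_le (min_le_right _ _))
  have h₃ := norm_sub_norm_le (f x) (g x)
  linarith
end

section
/- Let r be a positive integer, let Σ be a closed subset of ℝⁿ with 0 ∈ Σ, and let f: (ℝⁿ,0) → (ℝᵖ,0) be a C^r map-germ with n ≥ p. If f satisfies condition (K̃_Σ), then the relative r-jet j^r f(Σ;0) is Σ-V-sufficient in C^r mappings. -/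
/-- Condition `(K̃_Σ)`. -/
def KuoTildeRel {n p : ℕ} (r : ℕ) (S : Set (EuclideanSpace ℝ (Fin n)))
    (f : EuclideanSpace ℝ (Fin n) → EuclideanSpace ℝ (Fin p)) : Prop :=
  ∃ C > (0:ℝ), ∃ α > (0:ℝ), ∀ x : EuclideanSpace ℝ (Fin n), ‖x‖ < α →
    Metric.infDist x S * kuoD f x + ‖f x‖ ≥ C * Metric.infDist x S ^ r

/-- The relative r-jet `j^r f(Σ;0)` is `Σ`-`V`-sufficient in `C^s` mappings: any two `C^s`
realisations `g₁, g₂` of the relative jet have zero sets homeomorphic near the origin by a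
homeomorphism fixing the points of `Σ`. -/
def SigmaVSufficient {n p : ℕ} (r s : ℕ) (S : Set (EuclideanSpace ℝ (Fin n)))
    (f : EuclideanSpace ℝ (Fin n) → EuclideanSpace ℝ (Fin p)) : Prop :=
  ∀ g₁ g₂ : EuclideanSpace ℝ (Fin n) → EuclideanSpace ℝ (Fin p),
    ContDiff ℝ s g₁ → ContDiff ℝ s g₂ → g₁ 0 = 0 → g₂ 0 = 0 →
    jetEqual r S f g₁ → jetEqual r S f g₂ →
    ∃ U ∈ nhds (0 : EuclideanSpace ℝ (Fin n)), ∃ V ∈ nhds (0 : EuclideanSpace ℝ (Fin n)),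
      ∃ h : (g₁ ⁻¹' {0} ∩ U : Set (EuclideanSpace ℝ (Fin n))) ≃ₜ
            (g₂ ⁻¹' {0} ∩ V : Set (EuclideanSpace ℝ (Fin n))),
        ∀ x : (g₁ ⁻¹' {0} ∩ U : Set (EuclideanSpace ℝ (Fin n))),
          (x : EuclideanSpace ℝ (Fin n)) ∈ S → ((h x : EuclideanSpace ℝ (Fin n)) = x)

section Flow

open Set Metric Topology
open scoped NNReal

variable {E : Type*} [NormedAddCommGroup E]

/-- A time-dependent vector field on `[0, 1]` which is locally Lipschitz off `S` and is controlled
by the distance to `S`. -/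
structure ControlledField (S : Set E) (W : ℝ → E → E) : Prop where
  norm_le : ∀ t ∈ Icc (0 : ℝ) 1, ∀ x, ‖W t x‖ ≤ infDist x S / 8
  locallyLipschitzOn : LocallyLipschitzOn (Icc (0 : ℝ) 1 ×ˢ Sᶜ) (Function.uncurry W)

namespace ControlledField

variable {S : Set E} {W : ℝ → E → E}

lemma reverse (hW : ControlledField S W) : ControlledField S (fun t x => -W (1 - t) x) := by
  refine ⟨fun t ht x => ?_, ?_⟩
  · rw [norm_neg]
    exact hW.norm_le _ ⟨by linarith [ht.2], by linarith [ht.1]⟩ x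
  · rintro ⟨t, x⟩ ⟨ht, hx⟩
    have hm : MapsTo (fun p : ℝ × E => (1 - p.1, p.2)) (Icc (0 : ℝ) 1 ×ˢ Sᶜ)
        (Icc (0 : ℝ) 1 ×ˢ Sᶜ) := by
      rintro ⟨s, y⟩ ⟨hs, hy⟩
      exact ⟨⟨by linarith [hs.2], by linarith [hs.1]⟩, hy⟩
    obtain ⟨K, s, hs, hK⟩ :=
      hW.locallyLipschitzOn (hm (show (t, x) ∈ Icc (0 : ℝ) 1 ×ˢ Sᶜ from ⟨ht, hx⟩))
    have hφ : LipschitzWith 1 (fun p : ℝ × E => (1 - p.1, p.2)) := by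
      refine LipschitzWith.of_dist_le_mul fun p q => ?_
      have h : dist (1 - p.1) (1 - q.1) = dist p.1 q.1 := dist_sub_left _ _ _
      simp only [Prod.dist_eq, h, NNReal.coe_one, one_mul, le_refl]
    refine ⟨K * 1, (fun p : ℝ × E => (1 - p.1, p.2)) ⁻¹' s,
      (hφ.continuous.continuousWithinAt.tendsto_nhdsWithin hm) hs, ?_⟩
    have := (hK.comp (hφ.lipschitzOnWith (s := (fun p : ℝ × E => (1 - p.1, p.2)) ⁻¹' s))
      (fun _ h => h))
    intro p hp q hq
    have h := this hp hq
    simpa [Function.uncurry] using h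

lemma exists_lipschitz [ProperSpace E] (hW : ControlledField S W) (hS : IsClosed S)
    (hne : S.Nonempty) {x : E} (hx : x ∉ S) :
    ∃ K : ℝ≥0, LipschitzOnWith K (Function.uncurry W)
      (Icc (0 : ℝ) 1 ×ˢ closedBall x (infDist x S / 2)) := by
  have hd : 0 < infDist x S := (hS.notMem_iff_infDist_pos hne).1 hx
  refine LocallyLipschitzOn.exists_lipschitzOnWith_of_compact
    (isCompact_Icc.prod (isCompact_closedBall _ _)) (hW.locallyLipschitzOn.mono ?_)
  refine prod_mono le_rfl fun y hy hyS => ?_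
  have h1 := infDist_le_dist_of_mem (x := x) hyS
  rw [mem_closedBall, dist_comm] at hy
  linarith

lemma lipschitz_slice {A : Set E} {K : ℝ≥0}
    (hK : LipschitzOnWith K (Function.uncurry W) (Icc (0 : ℝ) 1 ×ˢ A)) {t : ℝ}
    (ht : t ∈ Icc (0 : ℝ) 1) : LipschitzOnWith K (W t) A := by
  refine LipschitzOnWith.of_dist_le_mul fun y hy z hz => ?_
  have := hK.dist_le_mul (t, y) ⟨ht, hy⟩ (t, z) ⟨ht, hz⟩
  simpa [Prod.dist_eq] using this

end ControlledField

variable [NormedSpace ℝ E]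

lemma IsIntegralCurveOn.hasDerivWithinAt_Ici {W : ℝ → E → E} {γ : ℝ → E}
    (hγ : IsIntegralCurveOn γ W (Icc 0 1)) {t : ℝ} (ht : t ∈ Ico (0 : ℝ) 1) :
    HasDerivWithinAt γ (W t (γ t)) (Ici t) t :=
  (hγ t ⟨ht.1, ht.2.le⟩).mono_of_mem_nhdsWithin (Icc_mem_nhdsGE_of_mem ht)

lemma IsIntegralCurveOn.reverse {W : ℝ → E → E} {γ : ℝ → E}
    (hγ : IsIntegralCurveOn γ W (Icc 0 1)) :
    IsIntegralCurveOn (fun t => γ (1 - t)) (fun t x => -W (1 - t) x) (Icc 0 1) := by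
  intro t ht
  have h1 : (1 - t) ∈ Icc (0 : ℝ) 1 := ⟨by linarith [ht.2], by linarith [ht.1]⟩
  have h2 : HasDerivWithinAt (fun t : ℝ => 1 - t) (-1) (Icc 0 1) t := by
    simpa using ((hasDerivWithinAt_id t (Icc (0 : ℝ) 1)).const_sub 1)
  have h3 := (hγ (1 - t) h1).scomp t h2 (fun s hs => ⟨by linarith [hs.2], by linarith [hs.1]⟩)
  simpa [Function.comp_def] using h3

namespace ControlledField

variable {S : Set E} {W : ℝ → E → E}

lemma dist_le (hW : ControlledField S W) {γ : ℝ → E}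
    (hγ : IsIntegralCurveOn γ W (Icc 0 1)) {t : ℝ} (ht : t ∈ Icc (0 : ℝ) 1) :
    dist (γ t) (γ 0) ≤ infDist (γ 0) S / 4 := by
  have key := norm_le_gronwallBound_of_norm_deriv_right_le (f := fun t => γ t - γ 0)
    (f' := fun t => W t (γ t)) (δ := 0) (K := 1 / 8) (ε := infDist (γ 0) S / 8) (a := 0) (b := 1)
    (hγ.continuousOn.sub continuousOn_const)
    (fun t ht => (hγ.hasDerivWithinAt_Ici ht).sub_const _) (by simp)
    (fun t ht => by
      have h1 := hW.norm_le t ⟨ht.1, ht.2.le⟩ (γ t)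
      have h2 : infDist (γ t) S ≤ infDist (γ 0) S + dist (γ t) (γ 0) := infDist_le_infDist_add_dist
      rw [dist_eq_norm] at h2
      linarith) t ht
  rw [dist_eq_norm]
  refine key.trans ?_
  have hd : 0 ≤ infDist (γ 0) S := infDist_nonneg
  rw [gronwallBound_of_K_ne_0 (by norm_num)]
  have h1 : Real.exp (1 / 8 * (t - 0)) ≤ 5 / 4 := by
    have h2 : Real.exp (1 / 8 * (t - 0)) ≤ Real.exp (1 / 8) :=
      Real.exp_le_exp.2 (by linarith [ht.2])
    have h3 : (7 / 8 : ℝ) ≤ Real.exp (-(1 / 8)) := by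
      have := Real.add_one_le_exp (-(1 / 8 : ℝ))
      linarith
    have h4 : Real.exp (1 / 8) * Real.exp (-(1 / 8)) = 1 := by
      rw [← Real.exp_add]; simp
    nlinarith [Real.exp_pos (1 / 8)]
  have h5 : infDist (γ 0) S / 8 / (1 / 8) = infDist (γ 0) S := by ring
  simp only [h5, zero_mul, zero_add]
  nlinarith

lemma exists_integralCurve [ProperSpace E] (hW : ControlledField S W)
    (hS : IsClosed S) (hne : S.Nonempty) (x : E) :
    ∃ γ : ℝ → E, γ 0 = x ∧ IsIntegralCurveOn γ W (Icc 0 1) := by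
  by_cases hx : x ∈ S
  · refine ⟨fun _ => x, rfl, fun t ht => ?_⟩
    have : W t x = 0 := by
      have := hW.norm_le t ht x
      rw [infDist_zero_of_mem hx] at this
      simpa using this
    rw [this]
    exact hasDerivWithinAt_const _ _ _
  obtain ⟨K, hK⟩ := hW.exists_lipschitz hS hne hx
  have hd : 0 < infDist x S := (hS.notMem_iff_infDist_pos hne).1 hx
  set a : ℝ≥0 := ⟨infDist x S / 2, by positivity⟩ with ha
  have hpl : IsPicardLindelof W (⟨0, by simp⟩ : Icc (0 : ℝ) 1) x a 0 a K := by
    refine ⟨fun t ht => lipschitz_slice hK ht, fun y hy => ?_, fun t ht y hy => ?_, ?_⟩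
    · exact hK.continuousOn.comp (f := fun t : ℝ => (t, y)) (by fun_prop) fun t ht => ⟨ht, hy⟩
    · have h1 := hW.norm_le t ht y
      have h2 : infDist y S ≤ infDist x S + dist y x := infDist_le_infDist_add_dist
      have h3 : dist y x ≤ infDist x S / 2 := hy
      change _ ≤ infDist x S / 2
      linarith
    · simp
  exact hpl.exists_eq_forall_mem_Icc_hasDerivWithinAt₀

lemma exists_dist_le_mul [ProperSpace E] (hW : ControlledField S W)
    (hS : IsClosed S) (hne : S.Nonempty) {x : E} (hx : x ∉ S) :
    ∃ C : ℝ, ∀ γ₁ γ₂ : ℝ → E, IsIntegralCurveOn γ₁ W (Icc 0 1) →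
      IsIntegralCurveOn γ₂ W (Icc 0 1) → γ₁ 0 = x → dist (γ₂ 0) x < infDist x S / 8 →
      dist (γ₂ 1) (γ₁ 1) ≤ C * dist (γ₂ 0) x := by
  obtain ⟨K, hK⟩ := hW.exists_lipschitz hS hne hx
  refine ⟨Real.exp K, fun γ₁ γ₂ h₁ h₂ h0 hlt => ?_⟩
  have key := dist_le_of_trajectories_ODE_of_mem (v := W) (K := K) (a := 0) (b := 1)
    (s := fun _ => closedBall x (infDist x S / 2)) (f := γ₂) (g := γ₁) (δ := dist (γ₂ 0) x)
    (fun t ht => lipschitz_slice hK ⟨ht.1, ht.2.le⟩) h₂.continuousOn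
    (fun t ht => h₂.hasDerivWithinAt_Ici ht) ?_ h₁.continuousOn
    (fun t ht => h₁.hasDerivWithinAt_Ici ht) ?_ (by rw [h0]) 1 ⟨zero_le_one, le_rfl⟩
  · rw [mul_comm]
    simpa using key
  · intro t ht
    have h3 := hW.dist_le h₂ (t := t) ⟨ht.1, ht.2.le⟩
    have h4 : infDist (γ₂ 0) S ≤ infDist x S + dist (γ₂ 0) x := infDist_le_infDist_add_dist
    have h5 := dist_triangle (γ₂ t) (γ₂ 0) x
    have h6 : 0 ≤ infDist x S := infDist_nonneg
    rw [mem_closedBall]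
    linarith
  · intro t ht
    have h3 := hW.dist_le h₁ (t := t) ⟨ht.1, ht.2.le⟩
    have h4 : 0 ≤ infDist x S := infDist_nonneg
    rw [h0] at h3
    rw [mem_closedBall]
    linarith

/-- Two integral curves starting at the same point have the same endpoint. -/
lemma endpoint_unique [ProperSpace E] (hW : ControlledField S W)
    (hS : IsClosed S) (hne : S.Nonempty) {γ₁ γ₂ : ℝ → E}
    (h₁ : IsIntegralCurveOn γ₁ W (Icc 0 1)) (h₂ : IsIntegralCurveOn γ₂ W (Icc 0 1))
    (h0 : γ₁ 0 = γ₂ 0) : γ₁ 1 = γ₂ 1 := by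
  have h1 : (1 : ℝ) ∈ Icc (0 : ℝ) 1 := ⟨zero_le_one, le_rfl⟩
  by_cases hx : γ₁ 0 ∈ S
  · have e₁ := hW.dist_le h₁ h1
    have e₂ := hW.dist_le h₂ h1
    rw [← h0] at e₂
    rw [infDist_zero_of_mem hx, zero_div, dist_le_zero] at e₁ e₂
    rw [e₁, e₂]
  · obtain ⟨C, hC⟩ := hW.exists_dist_le_mul hS hne hx
    have hd : 0 < infDist (γ₁ 0) S := (hS.notMem_iff_infDist_pos hne).1 hx
    have := hC γ₁ γ₂ h₁ h₂ rfl (by rw [← h0, dist_self]; positivity)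
    rw [← h0, dist_self, mul_zero, dist_le_zero] at this
    exact this.symm

lemma exists_timeOne_map [ProperSpace E] (hW : ControlledField S W)
    (hS : IsClosed S) (hne : S.Nonempty) :
    ∃ h : E → E, Continuous h ∧ ∀ γ, IsIntegralCurveOn γ W (Icc 0 1) → h (γ 0) = γ 1 := by
  choose Γ hΓ0 hΓ using hW.exists_integralCurve hS hne
  refine ⟨fun x => Γ x 1, continuous_iff_continuousAt.2 fun x => ?_, fun γ hγ =>
    hW.endpoint_unique hS hne (hΓ _) hγ (hΓ0 _)⟩
  have h1 : (1 : ℝ) ∈ Icc (0 : ℝ) 1 := ⟨zero_le_one, le_rfl⟩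
  by_cases hx : x ∈ S
  · refine continuousAt_of_locally_lipschitz (r := 1) zero_lt_one (5 / 4) fun y _ => ?_
    have e₁ := hW.dist_le (hΓ x) h1
    have e₂ := hW.dist_le (hΓ y) h1
    rw [hΓ0] at e₁ e₂
    rw [infDist_zero_of_mem hx, zero_div, dist_le_zero] at e₁
    rw [e₁]
    have e₃ := infDist_le_dist_of_mem (x := y) hx
    have e₄ := dist_triangle (Γ y 1) y x
    linarith
  · obtain ⟨C, hC⟩ := hW.exists_dist_le_mul hS hne hx
    have hd : 0 < infDist x S := (hS.notMem_iff_infDist_pos hne).1 hx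
    refine continuousAt_of_locally_lipschitz (r := infDist x S / 8) (by positivity) C fun y hy => ?_
    have := hC (Γ x) (Γ y) (hΓ x) (hΓ y) (hΓ0 x) (by rwa [hΓ0])
    rwa [hΓ0] at this

/-- The time-one map of a controlled field is a homeomorphism. -/
theorem exists_homeomorph [ProperSpace E] (hW : ControlledField S W)
    (hS : IsClosed S) (hne : S.Nonempty) :
    ∃ h : E ≃ₜ E, ∀ x, ∃ γ, γ 0 = x ∧ γ 1 = h x ∧ IsIntegralCurveOn γ W (Icc 0 1) := by
  obtain ⟨h, hc, hh⟩ := hW.exists_timeOne_map hS hne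
  obtain ⟨k, kc, hk⟩ := hW.reverse.exists_timeOne_map hS hne
  refine ⟨⟨⟨h, k, fun x => ?_, fun x => ?_⟩, hc, kc⟩, fun x => ?_⟩
  · obtain ⟨γ, rfl, hγ⟩ := hW.exists_integralCurve hS hne x
    have := hk _ hγ.reverse
    simpa [hh γ hγ] using this
  · obtain ⟨γ, rfl, hγ⟩ := hW.reverse.exists_integralCurve hS hne x
    have h1 := hγ.reverse
    simp only [sub_sub_cancel, neg_neg] at h1
    have := hh _ h1
    simpa [hk γ hγ] using this
  · obtain ⟨γ, rfl, hγ⟩ := hW.exists_integralCurve hS hne x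
    exact ⟨γ, rfl, (hh γ hγ).symm, hγ⟩

end ControlledField

end Flow
section Flat

open Set Metric Topology

variable {E F : Type*} [NormedAddCommGroup E] [NormedSpace ℝ E] [ProperSpace E]
  [NormedAddCommGroup F] [NormedSpace ℝ F]

/-- If the derivatives of `G` up to order `r` vanish on `S` near `0`, then its `k`-th derivative is
`o(d(x, S) ^ (r - k))`. -/
lemma norm_iteratedFDeriv_le_of_flat {S : Set E} (hS : IsClosed S) (h0 : (0 : E) ∈ S) {r : ℕ}
    {G : E → F} (hG : ContDiff ℝ r G)
    (hflat : ∃ U ∈ 𝓝 (0 : E), ∀ z ∈ S ∩ U, ∀ k ≤ r, iteratedFDeriv ℝ k G z = 0)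
    {ε : ℝ} (hε : 0 < ε) (j : ℕ) (hj : j ≤ r) :
    ∃ R > 0, ∀ x, ‖x‖ < R → ‖iteratedFDeriv ℝ (r - j) G x‖ ≤ ε * infDist x S ^ j := by
  obtain ⟨U, hU, hz⟩ := hflat
  obtain ⟨ρ, hρ, hρU⟩ := Metric.mem_nhds_iff.1 hU
  induction j with
  | zero =>
    have hc : Continuous (iteratedFDeriv ℝ r G) := hG.continuous_iteratedFDeriv le_rfl
    have h1 : iteratedFDeriv ℝ r G 0 = 0 := hz 0 ⟨h0, mem_of_mem_nhds hU⟩ r le_rfl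
    have h2 := hc.continuousAt (x := (0 : E))
    obtain ⟨R, hR, h⟩ := Metric.continuousAt_iff.1 h2 ε hε
    refine ⟨R, hR, fun x hx => ?_⟩
    have := h (x := x) (by simpa using hx)
    rw [h1, dist_zero_right] at this
    simpa using this.le
  | succ j ih =>
    obtain ⟨R, hR, h⟩ := ih (by omega)
    refine ⟨min R ρ / 2, by positivity, fun x hx => ?_⟩
    obtain ⟨z, hzS, hxz⟩ := hS.exists_infDist_eq_dist ⟨0, h0⟩ x
    have hx0 : infDist x S ≤ ‖x‖ := by simpa using infDist_le_dist_of_mem (x := x) h0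
    have hzx : ‖z - x‖ = infDist x S := by rw [hxz, dist_comm, dist_eq_norm]
    have hmR := min_le_left R ρ
    have hmρ := min_le_right R ρ
    have hzn : ‖z‖ < min R ρ := by
      have : ‖z‖ ≤ ‖z - x‖ + ‖x‖ := by simpa using norm_add_le (z - x) x
      linarith
    have hxn : ‖x‖ < min R ρ := by linarith [norm_nonneg x]
    have hk : r - j = (r - (j + 1)) + 1 := by omega
    have hdiff : Differentiable ℝ (iteratedFDeriv ℝ (r - (j + 1)) G) :=
      hG.differentiable_iteratedFDeriv (by exact_mod_cast (by omega : r - (j + 1) < r))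
    have hseg : ∀ y ∈ segment ℝ z x,
        ‖fderiv ℝ (iteratedFDeriv ℝ (r - (j + 1)) G) y‖ ≤ ε * infDist x S ^ j := by
      intro y hy
      rw [norm_fderiv_iteratedFDeriv, ← hk]
      have hyR : ‖y‖ < R := by
        have := (convex_ball (0 : E) (min R ρ)).segment_subset (x := z) (y := x)
          (by simpa using hzn) (by simpa using hxn) hy
        rw [mem_ball_zero_iff] at this
        linarith
      refine (h y hyR).trans ?_
      have hyd : infDist y S ≤ infDist x S := by
        refine (infDist_le_dist_of_mem hzS).trans ?_
        have := (convex_closedBall z (dist x z)).segment_subset (x := z) (y := x)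
          (by simp) (by simp) hy
        rw [hxz]
        exact this
      have := infDist_nonneg (x := y) (s := S)
      gcongr
    have hmv := (convex_segment z x).norm_image_sub_le_of_norm_fderiv_le (𝕜 := ℝ)
      (fun y _ => hdiff y) hseg (left_mem_segment ℝ z x) (right_mem_segment ℝ z x)
    rw [hz z ⟨hzS, hρU (by simpa using hzn.trans_le hmρ)⟩ _ (by omega), sub_zero,
      norm_sub_rev, hzx] at hmv
    rw [pow_succ]
    linarith

lemma norm_le_of_flat {S : Set E} (hS : IsClosed S) (h0 : (0 : E) ∈ S) {r : ℕ} (hr : 1 ≤ r)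
    {G : E → F} (hG : ContDiff ℝ r G)
    (hflat : ∃ U ∈ 𝓝 (0 : E), ∀ z ∈ S ∩ U, ∀ k ≤ r, iteratedFDeriv ℝ k G z = 0)
    {ε : ℝ} (hε : 0 < ε) :
    ∃ R > 0, ∀ x, ‖x‖ < R → ‖G x‖ ≤ ε * infDist x S ^ r ∧
      ‖fderiv ℝ G x‖ ≤ ε * infDist x S ^ (r - 1) := by
  obtain ⟨R₀, hR₀, h₀⟩ := norm_iteratedFDeriv_le_of_flat hS h0 hG hflat hε r le_rfl
  obtain ⟨R₁, hR₁, h₁⟩ := norm_iteratedFDeriv_le_of_flat hS h0 hG hflat hε (r - 1) (by omega)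
  refine ⟨min R₀ R₁, lt_min hR₀ hR₁, fun x hx => ⟨?_, ?_⟩⟩
  · have := h₀ x (hx.trans_le (min_le_left _ _))
    rwa [Nat.sub_self, norm_iteratedFDeriv_zero] at this
  · have := h₁ x (hx.trans_le (min_le_right _ _))
    rwa [show r - (r - 1) = 1 by omega, norm_iteratedFDeriv_one] at this

end Flat

section Kuo

open Set Metric Topology
open scoped InnerProduct

lemma kuo_mul_norm_le {n p : ℕ} (v : Fin p → EuclideanSpace ℝ (Fin n))
    (w : EuclideanSpace ℝ (Fin p)) : kuo v * ‖w‖ ≤ p * ‖∑ i, w i • v i‖ := by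
  have hnn : ∀ i, 0 ≤ infDist (v i)
      (Submodule.span ℝ (v '' {j | j ≠ i}) : Set (EuclideanSpace ℝ (Fin n))) :=
    fun _ => infDist_nonneg
  rcases Nat.eq_zero_or_pos p with rfl | hp
  · have : w = 0 := Subsingleton.elim _ _
    simp [this]
  have : Nonempty (Fin p) := ⟨⟨0, hp⟩⟩
  obtain ⟨i, hi⟩ := Finite.exists_max (fun i => ‖w i‖)
  have hκ0 : 0 ≤ kuo v := Real.iInf_nonneg hnn
  have hκ : kuo v ≤ infDist (v i)
      (Submodule.span ℝ (v '' {j | j ≠ i}) : Set (EuclideanSpace ℝ (Fin n))) :=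
    ciInf_le ⟨0, by rintro _ ⟨j, rfl⟩; exact hnn j⟩ i
  have hw : ‖w‖ ≤ p * ‖w i‖ := by
    have h1 : ‖w‖ ≤ ∑ j, ‖w j‖ := by
      conv_lhs => rw [← (EuclideanSpace.basisFun (Fin p) ℝ).sum_repr w]
      refine (norm_sum_le _ _).trans (Finset.sum_le_sum fun j _ => ?_)
      simp [norm_smul]
    refine h1.trans ((Finset.sum_le_sum fun j _ => hi j).trans ?_)
    simp
  have hmain : kuo v * ‖w i‖ ≤ ‖∑ j, w j • v j‖ := by
    by_cases hwi : w i = 0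
    · simp [hwi]
    have hs : ∑ j, w j • v j = w i • v i + ∑ j ∈ Finset.univ.erase i, w j • v j :=
      (Finset.add_sum_erase _ _ (Finset.mem_univ i)).symm
    set y := -((w i)⁻¹ • ∑ j ∈ Finset.univ.erase i, w j • v j) with hy
    have hmem : y ∈ Submodule.span ℝ (v '' {j | j ≠ i}) := by
      refine neg_mem (Submodule.smul_mem _ _ (Submodule.sum_mem _ fun j hj => ?_))
      exact Submodule.smul_mem _ _ (Submodule.subset_span ⟨j, Finset.ne_of_mem_erase hj, rfl⟩)
    have hfac : ∑ j, w j • v j = w i • (v i - y) := by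
      rw [hs, hy, sub_neg_eq_add, smul_add, smul_smul, mul_inv_cancel₀ hwi, one_smul]
    rw [hfac, norm_smul, mul_comm]
    gcongr
    refine hκ.trans ((infDist_le_dist_of_mem hmem).trans ?_)
    rw [dist_eq_norm]
  calc kuo v * ‖w‖ ≤ kuo v * (p * ‖w i‖) := by gcongr
    _ = p * (kuo v * ‖w i‖) := by ring
    _ ≤ _ := by gcongr

lemma sum_smul_grad {n p : ℕ} (f : EuclideanSpace ℝ (Fin n) → EuclideanSpace ℝ (Fin p))
    (x : EuclideanSpace ℝ (Fin n)) (w : EuclideanSpace ℝ (Fin p)) :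
    ∑ i, w i • grad f x i = ContinuousLinearMap.adjoint (fderiv ℝ f x) w := by
  conv_rhs => rw [← (EuclideanSpace.basisFun (Fin p) ℝ).sum_repr w]
  simp [grad, map_sum]

lemma KuoTildeRel.exists_lower_bound {n p r : ℕ} (hp : 1 ≤ p) {S : Set (EuclideanSpace ℝ (Fin n))}
    {f : EuclideanSpace ℝ (Fin n) → EuclideanSpace ℝ (Fin p)} (h : KuoTildeRel r S f) :
    ∃ c > 0, ∃ α > 0, ∀ x, ‖x‖ < α → ∀ w, c * infDist x S ^ r * ‖w‖ ≤
      infDist x S * ‖ContinuousLinearMap.adjoint (fderiv ℝ f x) w‖ + ‖f x‖ * ‖w‖ := by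
  obtain ⟨C, hC, α, hα, h⟩ := h
  have hp' : (1 : ℝ) ≤ p := by exact_mod_cast hp
  refine ⟨C / p, by positivity, α, hα, fun x hx w => ?_⟩
  have h1 := kuo_mul_norm_le (grad f x) w
  rw [sum_smul_grad] at h1
  have h2 := h x hx
  have hd : 0 ≤ infDist x S := infDist_nonneg
  have h3 : C * infDist x S ^ r * ‖w‖ ≤
      p * (infDist x S * ‖ContinuousLinearMap.adjoint (fderiv ℝ f x) w‖ + ‖f x‖ * ‖w‖) := by
    calc _ ≤ (infDist x S * kuoD f x + ‖f x‖) * ‖w‖ := by gcongr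
      _ = infDist x S * (kuo (grad f x) * ‖w‖) + 1 * (‖f x‖ * ‖w‖) := by rw [kuoD]; ring
      _ ≤ infDist x S * (p * ‖ContinuousLinearMap.adjoint (fderiv ℝ f x) w‖)
          + p * (‖f x‖ * ‖w‖) := by gcongr
      _ = _ := by ring
  rw [div_mul_eq_mul_div, div_mul_eq_mul_div, div_le_iff₀ (by positivity)]
  linarith

variable {E F : Type*} [NormedAddCommGroup E] [InnerProductSpace ℝ E] [CompleteSpace E]
  [NormedAddCommGroup F] [InnerProductSpace ℝ F] [CompleteSpace F]

lemma lower_bound_of_close {D₀ D : E →L[ℝ] F} {y₀ y : F} {c d ε : ℝ} (hd : 0 ≤ d) {r : ℕ}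
    (hr : 1 ≤ r) (hD : ‖D - D₀‖ ≤ ε * d ^ (r - 1)) (hy : ‖y - y₀‖ ≤ ε * d ^ r) {w : F}
    (h : c * d ^ r * ‖w‖ ≤ d * ‖ContinuousLinearMap.adjoint D₀ w‖ + ‖y₀‖ * ‖w‖) :
    (c - 2 * ε) * d ^ r * ‖w‖ ≤ d * ‖ContinuousLinearMap.adjoint D w‖ + ‖y‖ * ‖w‖ := by
  have h1 : ‖ContinuousLinearMap.adjoint D₀ w‖ ≤
      ‖ContinuousLinearMap.adjoint D w‖ + ε * d ^ (r - 1) * ‖w‖ := by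
    have e : ContinuousLinearMap.adjoint D₀ w =
        ContinuousLinearMap.adjoint D w - ContinuousLinearMap.adjoint (D - D₀) w := by
      rw [map_sub, sub_apply]; abel
    rw [e]
    refine (norm_sub_le _ _).trans ?_
    gcongr
    refine (ContinuousLinearMap.le_opNorm _ _).trans ?_
    rw [LinearIsometryEquiv.norm_map]
    gcongr
  have h2 : ‖y₀‖ ≤ ‖y‖ + ε * d ^ r := by
    have : ‖y₀‖ ≤ ‖y‖ + ‖y - y₀‖ := by
      have := norm_sub_le y (y - y₀)
      simpa using this
    linarith
  have h3 : d * d ^ (r - 1) = d ^ r := by rw [← pow_succ']; congr 1; omega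
  have h4 : d * ‖ContinuousLinearMap.adjoint D₀ w‖ ≤
      d * ‖ContinuousLinearMap.adjoint D w‖ + ε * d ^ r * ‖w‖ := by
    calc _ ≤ d * (‖ContinuousLinearMap.adjoint D w‖ + ε * d ^ (r - 1) * ‖w‖) := by gcongr
      _ = d * ‖ContinuousLinearMap.adjoint D w‖ + ε * (d * d ^ (r - 1)) * ‖w‖ := by ring
      _ = _ := by rw [h3]
  have h5 : ‖y₀‖ * ‖w‖ ≤ (‖y‖ + ε * d ^ r) * ‖w‖ := by gcongr
  linarith

/-- The regularised Gram operator `u² D D* + a²`. -/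
noncomputable def regGram (D : E →L[ℝ] F) (u a : ℝ) : F →L[ℝ] F :=
  u ^ 2 • (D ∘L ContinuousLinearMap.adjoint D) + a ^ 2 • (1 : F →L[ℝ] F)

lemma regGram_apply (D : E →L[ℝ] F) (u a : ℝ) (w : F) :
    regGram D u a w = u ^ 2 • D (ContinuousLinearMap.adjoint D w) + a ^ 2 • w := rfl

lemma inner_regGram (D : E →L[ℝ] F) (u a : ℝ) (w : F) :
    inner ℝ (regGram D u a w) w =
      u ^ 2 * ‖ContinuousLinearMap.adjoint D w‖ ^ 2 + a ^ 2 * ‖w‖ ^ 2 := by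
  rw [regGram_apply, inner_add_left, inner_smul_left, inner_smul_left,
    real_inner_self_eq_norm_sq, ← ContinuousLinearMap.adjoint_inner_right,
    real_inner_self_eq_norm_sq]
  simp

lemma norm_le_norm_regGram {D : E →L[ℝ] F} {u a m : ℝ} {w : F} (hm : 0 ≤ m)
    (h : m * ‖w‖ ≤ u * ‖ContinuousLinearMap.adjoint D w‖ + a * ‖w‖) :
    m ^ 2 * ‖w‖ ≤ 2 * ‖regGram D u a w‖ := by
  rcases (norm_nonneg w).eq_or_lt with hw | hw
  · rw [← hw]; simp
  have h1 := real_inner_le_norm (regGram D u a w) w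
  rw [inner_regGram] at h1
  set z := ‖ContinuousLinearMap.adjoint D w‖
  have h2 : (m * ‖w‖) ^ 2 ≤ (u * z + a * ‖w‖) ^ 2 := by gcongr
  have h3 : (m ^ 2 * ‖w‖) * ‖w‖ ≤ (2 * ‖regGram D u a w‖) * ‖w‖ := by
    nlinarith [sq_nonneg (u * z - a * ‖w‖)]
  exact le_of_mul_le_mul_right h3 hw

lemma norm_adjoint_sq_le_regGram (D : E →L[ℝ] F) (u a : ℝ) (w : F) :
    u ^ 2 * ‖ContinuousLinearMap.adjoint D w‖ ^ 2 ≤ ‖regGram D u a w‖ * ‖w‖ := by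
  have h1 := real_inner_le_norm (regGram D u a w) w
  rw [inner_regGram] at h1
  nlinarith [mul_nonneg (sq_nonneg a) (sq_nonneg ‖w‖)]

lemma isUnit_regGram [FiniteDimensional ℝ F] {D : E →L[ℝ] F} {u a m : ℝ} (hm : 0 < m)
    (h : ∀ w, m * ‖w‖ ≤ u * ‖ContinuousLinearMap.adjoint D w‖ + a * ‖w‖) :
    IsUnit (regGram D u a) := by
  rw [ContinuousLinearMap.isUnit_iff_bijective]
  have hinj : Function.Injective (regGram D u a) := by
    rw [injective_iff_map_eq_zero]
    intro w hw
    have := norm_le_norm_regGram hm.le (h w)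
    rw [hw, norm_zero, mul_zero] at this
    have h2 : ‖w‖ ≤ 0 := by
      by_contra hcon
      push Not at hcon
      have : 0 < m ^ 2 * ‖w‖ := by positivity
      linarith
    exact norm_le_zero_iff.1 h2
  exact ⟨hinj, LinearMap.surjective_of_injective (f := (regGram D u a : F →ₗ[ℝ] F)) hinj⟩

end Kuo
section Field

open Set Metric Topology
open scoped NNReal

lemma eq_zero_iff_of_norm_deriv_le {F : Type*} [NormedAddCommGroup F] [NormedSpace ℝ F]
    {φ φ' : ℝ → F} {K : ℝ} (hφ : ∀ t ∈ Icc (0 : ℝ) 1, HasDerivWithinAt φ (φ' t) (Icc 0 1) t)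
    (hK : ∀ t ∈ Icc (0 : ℝ) 1, ‖φ' t‖ ≤ K * ‖φ t‖) : φ 0 = 0 ↔ φ 1 = 0 := by
  have aux : ∀ (ψ ψ' : ℝ → F), (∀ t ∈ Icc (0 : ℝ) 1, HasDerivWithinAt ψ (ψ' t) (Icc 0 1) t) →
      (∀ t ∈ Icc (0 : ℝ) 1, ‖ψ' t‖ ≤ K * ‖ψ t‖) → ψ 0 = 0 → ψ 1 = 0 := fun ψ ψ' h1 h2 h0 =>
    eq_zero_of_abs_deriv_le_mul_abs_self_of_eq_zero_right (f := ψ) (f' := ψ') (K := K) (a := 0)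
      (b := 1) (fun t ht => (h1 t ht).continuousWithinAt)
      (fun t ht => (h1 t ⟨ht.1, ht.2.le⟩).mono_of_mem_nhdsWithin (Icc_mem_nhdsGE_of_mem ht)) h0
      (fun t ht => h2 t ⟨ht.1, ht.2.le⟩) 1 ⟨zero_le_one, le_rfl⟩
  have hr : ∀ t ∈ Icc (0 : ℝ) 1, 1 - t ∈ Icc (0 : ℝ) 1 :=
    fun t ht => ⟨by linarith [ht.2], by linarith [ht.1]⟩
  refine ⟨aux φ φ' hφ hK, fun h1 => ?_⟩
  have := aux (fun t => φ (1 - t)) (fun t => -φ' (1 - t)) (fun t ht => ?_)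
    (fun t ht => by simpa using hK _ (hr t ht)) (by simpa using h1)
  · simpa using this
  · have h2 : HasDerivWithinAt (fun t : ℝ => 1 - t) (-1) (Icc 0 1) t := by
      simpa using ((hasDerivWithinAt_id t (Icc (0 : ℝ) 1)).const_sub 1)
    simpa [Function.comp_def] using (hφ (1 - t) (hr t ht)).scomp t h2 hr

/-- A Lipschitz cutoff, equal to `1` for `‖x‖ ≤ R / 2` and to `0` for `R ≤ ‖x‖`. -/
noncomputable def cutoff {E : Type*} [NormedAddCommGroup E] (R : ℝ) (x : E) : ℝ :=
  max 0 (min 1 (2 - 2 / R * ‖x‖))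

lemma exists_lipschitzWith_cutoff {E : Type*} [NormedAddCommGroup E] (R : ℝ) :
    ∃ K, LipschitzWith K (cutoff (E := E) R) := by
  have h : LipschitzWith ‖2 / R‖₊ (fun x : E => 2 - 2 / R * ‖x‖) := by
    refine LipschitzWith.of_dist_le_mul fun x y => ?_
    rw [dist_sub_left, Real.dist_eq, ← mul_sub, abs_mul, dist_eq_norm]
    exact mul_le_mul_of_nonneg_left (abs_norm_sub_norm_le x y) (abs_nonneg _)
  exact ⟨_, (h.const_min 1).const_max 0⟩

lemma cutoff_nonneg {E : Type*} [NormedAddCommGroup E] (R : ℝ) (x : E) : 0 ≤ cutoff R x :=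
  le_max_left _ _

lemma cutoff_le_one {E : Type*} [NormedAddCommGroup E] (R : ℝ) (x : E) : cutoff R x ≤ 1 :=
  max_le zero_le_one (min_le_left _ _)

lemma cutoff_eq_one {E : Type*} [NormedAddCommGroup E] {R : ℝ} (hR : 0 < R) {x : E}
    (hx : ‖x‖ ≤ R / 2) : cutoff R x = 1 := by
  have h : 2 / R * ‖x‖ ≤ 1 := by
    rw [div_mul_eq_mul_div, div_le_one hR]; linarith
  rw [cutoff, min_eq_left (by linarith), max_eq_right zero_le_one]

lemma cutoff_mul_le {E : Type*} [NormedAddCommGroup E] {R : ℝ} (hR : 0 < R) {x : E}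
    (hx : ‖x‖ ≤ R) : cutoff R x * R ≤ 2 * (R - ‖x‖) := by
  have h : cutoff R x ≤ 2 - 2 / R * ‖x‖ := by
    refine max_le ?_ (min_le_right _ _)
    have : 2 / R * ‖x‖ ≤ 2 := by rw [div_mul_eq_mul_div, div_le_iff₀ hR]; linarith
    linarith
  calc _ ≤ (2 - 2 / R * ‖x‖) * R := by gcongr
    _ = _ := by field_simp

lemma cutoff_eq_zero {E : Type*} [NormedAddCommGroup E] {R : ℝ} (hR : 0 < R) {x : E}
    (hx : R ≤ ‖x‖) : cutoff R x = 0 := by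
  have : 2 ≤ 2 / R * ‖x‖ := by rw [div_mul_eq_mul_div, le_div_iff₀ hR]; linarith
  exact max_eq_left ((min_le_right _ _).trans (by linarith))

variable {E F : Type*} [NormedAddCommGroup E] [InnerProductSpace ℝ E] [FiniteDimensional ℝ E]
  [NormedAddCommGroup F] [InnerProductSpace ℝ F] [FiniteDimensional ℝ F]

local instance : CompleteSpace E := FiniteDimensional.complete ℝ E
local instance : CompleteSpace F := FiniteDimensional.complete ℝ F

/-- The derivative in `x` of the linear homotopy between `g₁` and `g₂`. -/
noncomputable def homotopyDeriv (g₁ g₂ : E → F) (t : ℝ) (x : E) : E →L[ℝ] F :=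
  fderiv ℝ g₁ x + t • (fderiv ℝ g₂ x - fderiv ℝ g₁ x)

/-- The linear homotopy between `g₁` and `g₂`. -/
def linHomotopy (g₁ g₂ : E → F) (t : ℝ) (x : E) : F := g₁ x + t • (g₂ x - g₁ x)

/-- The solution `w` of `(u² D D* + ‖y‖²) w = g₂ x - g₁ x`, where `y` and `D` are the value and the
derivative of the linear homotopy at `(t, x)`. -/
noncomputable def kuoMultiplier (g₁ g₂ : E → F) (t : ℝ) (x : E) (u : ℝ) : F :=
  Ring.inverse (regGram (homotopyDeriv g₁ g₂ t x) u ‖linHomotopy g₁ g₂ t x‖) (g₂ x - g₁ x)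

/-- The regularised Kuo vector field, with free scalar parameters `u` and `s`. -/
noncomputable def kuoFieldAux (g₁ g₂ : E → F) (q : ℝ × E × ℝ × ℝ) : E :=
  -((q.2.2.2 * q.2.2.1 ^ 2) • ContinuousLinearMap.adjoint (homotopyDeriv g₁ g₂ q.1 q.2.1)
    (kuoMultiplier g₁ g₂ q.1 q.2.1 q.2.2.1))

/-- The regularised Kuo vector field, cut off outside the ball of radius `R`. -/
noncomputable def kuoField (g₁ g₂ : E → F) (S : Set E) (R t : ℝ) (x : E) : E :=
  kuoFieldAux g₁ g₂ (t, x, infDist x S, cutoff R x)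

lemma contDiff_adjoint {k : WithTop ℕ∞} :
    ContDiff ℝ k (fun D : E →L[ℝ] F => ContinuousLinearMap.adjoint D) := by
  let L : (E →L[ℝ] F) →ₗ[ℝ] (F →L[ℝ] E) :=
    { toFun := fun D => ContinuousLinearMap.adjoint D
      map_add' := fun _ _ => map_add _ _ _
      map_smul' := fun c D => by simp }
  exact (LinearMap.toContinuousLinearMap L).contDiff

lemma contDiffAt_kuoFieldAux {g₁ g₂ : E → F} (h₁ : ContDiff ℝ 2 g₁) (h₂ : ContDiff ℝ 2 g₂)
    {q : ℝ × E × ℝ × ℝ}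
    (hq : IsUnit (regGram (homotopyDeriv g₁ g₂ q.1 q.2.1) q.2.2.1 ‖linHomotopy g₁ g₂ q.1 q.2.1‖)) :
    ContDiffAt ℝ 1 (kuoFieldAux g₁ g₂) q := by
  have hf₁ : ContDiff ℝ 1 (fderiv ℝ g₁) := h₁.fderiv_right (by norm_num)
  have hf₂ : ContDiff ℝ 1 (fderiv ℝ g₂) := h₂.fderiv_right (by norm_num)
  have h₁' : ContDiff ℝ 1 g₁ := h₁.of_le (by norm_num)
  have h₂' : ContDiff ℝ 1 g₂ := h₂.of_le (by norm_num)
  have hD : ContDiff ℝ 1 (fun q : ℝ × E × ℝ × ℝ => homotopyDeriv g₁ g₂ q.1 q.2.1) := by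
    unfold homotopyDeriv; fun_prop
  have hA : ContDiff ℝ 1 (fun q : ℝ × E × ℝ × ℝ =>
      ContinuousLinearMap.adjoint (homotopyDeriv g₁ g₂ q.1 q.2.1)) := contDiff_adjoint.comp hD
  have hy : ContDiff ℝ 1 (fun q : ℝ × E × ℝ × ℝ => ‖linHomotopy g₁ g₂ q.1 q.2.1‖ ^ 2) := by
    refine ContDiff.norm_sq ℝ ?_
    unfold linHomotopy; fun_prop
  have hu : ContDiff ℝ 1 (fun q : ℝ × E × ℝ × ℝ => q.2.2.1 ^ 2) := by fun_prop
  have hQ : ContDiff ℝ 1 (fun q : ℝ × E × ℝ × ℝ =>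
      regGram (homotopyDeriv g₁ g₂ q.1 q.2.1) q.2.2.1 ‖linHomotopy g₁ g₂ q.1 q.2.1‖) :=
    (hu.smul (hD.clm_comp hA)).add (hy.smul contDiff_const)
  obtain ⟨a, ha⟩ := hq
  have hinv : ContDiffAt ℝ 1 (fun q : ℝ × E × ℝ × ℝ => Ring.inverse
      (regGram (homotopyDeriv g₁ g₂ q.1 q.2.1) q.2.2.1 ‖linHomotopy g₁ g₂ q.1 q.2.1‖)) q := by
    have h := contDiffAt_ringInverse ℝ (n := 1) a
    rw [ha] at h
    exact h.comp q hQ.contDiffAt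
  have hv : ContDiff ℝ 1 (fun q : ℝ × E × ℝ × ℝ => g₂ q.2.1 - g₁ q.2.1) := by fun_prop
  have hs : ContDiff ℝ 1 (fun q : ℝ × E × ℝ × ℝ => q.2.2.2 * q.2.2.1 ^ 2) := by fun_prop
  exact (hs.contDiffAt.smul (hA.contDiffAt.clm_apply (hinv.clm_apply hv.contDiffAt))).neg

/-- Quantitative nondegeneracy of the linear homotopy between `g₁` and `g₂` on a ball. -/
structure Nondegenerate (g₁ g₂ : E → F) (S : Set E) (r : ℕ) (R c : ℝ) : Prop where
  pos : 0 < c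
  radius_pos : 0 < R
  lower : ∀ x, ‖x‖ < R → ∀ t ∈ Icc (0 : ℝ) 1, ∀ w, c * infDist x S ^ r * ‖w‖ ≤
    infDist x S * ‖ContinuousLinearMap.adjoint (homotopyDeriv g₁ g₂ t x) w‖ +
      ‖linHomotopy g₁ g₂ t x‖ * ‖w‖
  close : ∀ x, ‖x‖ < R → ‖g₂ x - g₁ x‖ ≤ c / 32 * infDist x S ^ r

namespace Nondegenerate

variable {g₁ g₂ : E → F} {S : Set E} {r : ℕ} {R c : ℝ}

lemma isUnit (h : Nondegenerate g₁ g₂ S r R c) {x : E} (hx : ‖x‖ < R) (hd : 0 < infDist x S)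
    {t : ℝ} (ht : t ∈ Icc (0 : ℝ) 1) :
    IsUnit (regGram (homotopyDeriv g₁ g₂ t x) (infDist x S) ‖linHomotopy g₁ g₂ t x‖) :=
  have := h.pos
  isUnit_regGram (m := c * infDist x S ^ r) (by positivity) (h.lower x hx t ht)

lemma regGram_kuoMultiplier (h : Nondegenerate g₁ g₂ S r R c) {x : E} (hx : ‖x‖ < R)
    (hd : 0 < infDist x S) {t : ℝ} (ht : t ∈ Icc (0 : ℝ) 1) :
    regGram (homotopyDeriv g₁ g₂ t x) (infDist x S) ‖linHomotopy g₁ g₂ t x‖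
      (kuoMultiplier g₁ g₂ t x (infDist x S)) = g₂ x - g₁ x := by
  have := Ring.mul_inverse_cancel _ (h.isUnit hx hd ht)
  exact DFunLike.congr_fun this (g₂ x - g₁ x)

lemma norm_kuoMultiplier_le (h : Nondegenerate g₁ g₂ S r R c) {x : E} (hx : ‖x‖ < R)
    (hd : 0 < infDist x S) {t : ℝ} (ht : t ∈ Icc (0 : ℝ) 1) :
    (c * infDist x S ^ r) ^ 2 * ‖kuoMultiplier g₁ g₂ t x (infDist x S)‖ ≤
      2 * ‖g₂ x - g₁ x‖ := by
  have := h.pos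
  have h1 := norm_le_norm_regGram (m := c * infDist x S ^ r) (by positivity)
    (h.lower x hx t ht (kuoMultiplier g₁ g₂ t x (infDist x S)))
  rwa [h.regGram_kuoMultiplier hx hd ht] at h1

lemma norm_kuoField_le (h : Nondegenerate g₁ g₂ S r R c) {x : E} (hx : ‖x‖ < R)
    {t : ℝ} (ht : t ∈ Icc (0 : ℝ) 1) :
    ‖kuoField g₁ g₂ S R t x‖ ≤ cutoff R x * (infDist x S / 16) := by
  have hc := h.pos
  set d := infDist x S with hd_def
  set w := kuoMultiplier g₁ g₂ t x d with hw
  set z := ‖ContinuousLinearMap.adjoint (homotopyDeriv g₁ g₂ t x) w‖ with hz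
  have e : ‖kuoField g₁ g₂ S R t x‖ = cutoff R x * (d ^ 2 * z) := by
    rw [kuoField, kuoFieldAux, norm_neg, norm_smul, Real.norm_eq_abs, abs_of_nonneg
      (mul_nonneg (cutoff_nonneg R x) (sq_nonneg _)), mul_assoc]
  rw [e]
  refine mul_le_mul_of_nonneg_left ?_ (cutoff_nonneg R x)
  rcases (infDist_nonneg : 0 ≤ infDist x S).eq_or_lt with hd | hd
  · rw [← hd_def] at hd
    simp [← hd]
  have h1 := h.norm_kuoMultiplier_le hx hd ht
  have h2 := norm_adjoint_sq_le_regGram (homotopyDeriv g₁ g₂ t x) d ‖linHomotopy g₁ g₂ t x‖ w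
  rw [h.regGram_kuoMultiplier hx hd ht] at h2
  rw [← hd_def, ← hw] at h1
  have h3 := h.close x hx
  rw [← hd_def] at h3
  rw [← hd_def] at hd
  rw [← hz] at h2
  set v := ‖g₂ x - g₁ x‖
  set m := c * d ^ r with hm
  have hm0 : 0 < m := by positivity
  have hv : v ≤ m / 32 := by rw [hm]; linarith
  have hv0 : 0 ≤ v := norm_nonneg _
  have h4 : m ^ 2 * (d * z) ^ 2 ≤ m ^ 2 * (1 / 16) ^ 2 := by
    calc m ^ 2 * (d * z) ^ 2 = m ^ 2 * (d ^ 2 * z ^ 2) := by ring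
      _ ≤ m ^ 2 * (v * ‖w‖) := by gcongr
      _ = v * (m ^ 2 * ‖w‖) := by ring
      _ ≤ v * (2 * v) := by gcongr
      _ ≤ m / 32 * (2 * (m / 32)) := by gcongr
      _ ≤ _ := by nlinarith [sq_nonneg m]
  have h5 : d * z ≤ 1 / 16 :=
    le_of_sq_le_sq (le_of_mul_le_mul_left h4 (by positivity)) (by norm_num)
  calc d ^ 2 * z = d * (d * z) := by ring
    _ ≤ d * (1 / 16) := by gcongr
    _ = d / 16 := by ring

lemma controlledField (h : Nondegenerate g₁ g₂ S r R c) (h₁ : ContDiff ℝ 2 g₁)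
    (h₂ : ContDiff ℝ 2 g₂) (hS : IsClosed S) (h0 : (0 : E) ∈ S) :
    ControlledField (S ∪ (ball (0 : E) R)ᶜ) (kuoField g₁ g₂ S R) := by
  have hR := h.radius_pos
  refine ⟨fun t ht x => ?_, ?_⟩
  · suffices hs : 8 * ‖kuoField g₁ g₂ S R t x‖ ≤ infDist x (S ∪ (ball (0 : E) R)ᶜ) by linarith
    by_cases hx : ‖x‖ < R
    · have h1 := h.norm_kuoField_le hx ht
      have hd0 : 0 ≤ infDist x S := infDist_nonneg
      have hd : infDist x S ≤ ‖x‖ := by simpa using infDist_le_dist_of_mem (x := x) h0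
      refine (le_infDist ⟨0, mem_union_left _ h0⟩).2 ?_
      rintro y (hy | hy)
      · have h2 := infDist_le_dist_of_mem (x := x) hy
        have h3 : cutoff R x * (infDist x S / 16) ≤ 1 * (infDist x S / 16) := by
          have := cutoff_le_one R x
          gcongr
        linarith
      · have h2 : R ≤ ‖y‖ := by simpa using hy
        have h3 : R - ‖x‖ ≤ dist x y := by
          have := norm_sub_norm_le y x
          rw [dist_comm, dist_eq_norm]
          linarith
        have h4 := cutoff_mul_le hR hx.le
        have h5 : cutoff R x * (infDist x S / 16) ≤ cutoff R x * (R / 16) := by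
          have := cutoff_nonneg R x
          have : infDist x S ≤ R := by linarith
          gcongr
        linarith
    · have : kuoField g₁ g₂ S R t x = 0 := by
        simp [kuoField, kuoFieldAux, cutoff_eq_zero hR (not_lt.1 hx)]
      rw [this, norm_zero, mul_zero]
      exact infDist_nonneg
  · rintro ⟨t, x⟩ ⟨ht, hx⟩
    simp only [compl_union, compl_compl, mem_inter_iff, mem_compl_iff, mem_ball_zero_iff] at hx
    have hd : 0 < infDist x S := (hS.notMem_iff_infDist_pos ⟨0, h0⟩).1 hx.1
    obtain ⟨K, N, hN, hK⟩ := (contDiffAt_kuoFieldAux h₁ h₂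
      (q := (t, x, infDist x S, cutoff R x)) (h.isUnit hx.2 hd ht)).exists_lipschitzOnWith
    obtain ⟨L, hL⟩ := exists_lipschitzWith_cutoff (E := E) R
    have hψ := (LipschitzWith.prod_fst (α := ℝ) (β := E)).prodMk
      ((LipschitzWith.prod_snd (α := ℝ) (β := E)).prodMk
        (((lipschitz_infDist_pt S).comp (LipschitzWith.prod_snd (α := ℝ) (β := E))).prodMk
          (hL.comp (LipschitzWith.prod_snd (α := ℝ) (β := E)))))
    refine ⟨_, _, mem_nhdsWithin_of_mem_nhds (hψ.continuous.continuousAt.preimage_mem_nhds hN),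
      hK.comp hψ.lipschitzOnWith fun _ h => h⟩

lemma linHomotopy_eq_zero_iff (h : Nondegenerate g₁ g₂ S r R c) (h₁ : ContDiff ℝ 2 g₁)
    (h₂ : ContDiff ℝ 2 g₂) (hS : IsClosed S) (h0 : (0 : E) ∈ S) {γ : ℝ → E}
    (hγ : IsIntegralCurveOn γ (kuoField g₁ g₂ S R) (Icc 0 1)) (hγ0 : ‖γ 0‖ < R / 4)
    (hγS : γ 0 ∉ S) : g₁ (γ 0) = 0 ↔ g₂ (γ 1) = 0 := by
  have hR := h.radius_pos
  have hc := h.pos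
  set S' := S ∪ (ball (0 : E) R)ᶜ with hS'
  have hW := h.controlledField h₁ h₂ hS h0
  have hcl : IsClosed S' := hS.union isOpen_ball.isClosed_compl
  have hmem : γ 0 ∉ S' := by
    simp only [hS', mem_union, mem_compl_iff, mem_ball_zero_iff, not_or, not_not]
    exact ⟨hγS, by linarith⟩
  set δ := infDist (γ 0) S' with hδ
  have hδ0 : 0 < δ := (hcl.notMem_iff_infDist_pos ⟨0, Or.inl h0⟩).1 hmem
  have hδn : δ ≤ ‖γ 0‖ := by simpa using infDist_le_dist_of_mem (x := γ 0) (s := S') (Or.inl h0)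
  have hnear : ∀ t ∈ Icc (0 : ℝ) 1, ‖γ t‖ < R / 2 ∧ δ / 2 ≤ infDist (γ t) S := by
    intro t ht
    have h3 := hW.dist_le hγ ht
    rw [← hδ] at h3
    constructor
    · have := norm_le_norm_add_norm_sub (γ 0) (γ t)
      rw [dist_comm, dist_eq_norm] at h3
      linarith
    · have h4 : infDist (γ t) S' ≤ infDist (γ t) S :=
        infDist_le_infDist_of_subset subset_union_left ⟨0, h0⟩
      have h5 : δ ≤ infDist (γ t) S' + dist (γ 0) (γ t) := infDist_le_infDist_add_dist
      rw [dist_comm] at h5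
      linarith
  have hd₁ : Differentiable ℝ g₁ := h₁.differentiable (by norm_num)
  have hd₂ : Differentiable ℝ g₂ := h₂.differentiable (by norm_num)
  set w := fun t => kuoMultiplier g₁ g₂ t (γ t) (infDist (γ t) S) with hw
  have hder : ∀ t ∈ Icc (0 : ℝ) 1, HasDerivWithinAt (fun t => linHomotopy g₁ g₂ t (γ t))
      (‖linHomotopy g₁ g₂ t (γ t)‖ ^ 2 • w t) (Icc 0 1) t := by
    intro t ht
    have e₁ := (hd₁ (γ t)).hasFDerivAt.comp_hasDerivWithinAt t (hγ t ht)
    have e₂ := (hd₂ (γ t)).hasFDerivAt.comp_hasDerivWithinAt t (hγ t ht)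
    have e₃ := e₁.add ((hasDerivWithinAt_id t (Icc (0 : ℝ) 1)).smul (e₂.sub e₁))
    refine e₃.congr_deriv ?_
    obtain ⟨hn, hdist⟩ := hnear t ht
    have hq := h.regGram_kuoMultiplier (x := γ t) (by linarith) (by linarith) ht
    rw [regGram_apply] at hq
    have hf : kuoField g₁ g₂ S R t (γ t) = -(infDist (γ t) S ^ 2 •
        ContinuousLinearMap.adjoint (homotopyDeriv g₁ g₂ t (γ t)) (w t)) := by
      rw [kuoField, kuoFieldAux, cutoff_eq_one hR hn.le, one_mul]
    have hD : homotopyDeriv g₁ g₂ t (γ t) (kuoField g₁ g₂ S R t (γ t)) =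
        ‖linHomotopy g₁ g₂ t (γ t)‖ ^ 2 • w t - (g₂ (γ t) - g₁ (γ t)) := by
      rw [← hq, hf, map_neg, map_smul]
      abel
    have hD' : homotopyDeriv g₁ g₂ t (γ t) (kuoField g₁ g₂ S R t (γ t)) =
        fderiv ℝ g₁ (γ t) (kuoField g₁ g₂ S R t (γ t)) +
        t • (fderiv ℝ g₂ (γ t) (kuoField g₁ g₂ S R t (γ t)) -
          fderiv ℝ g₁ (γ t) (kuoField g₁ g₂ S R t (γ t))) := rfl
    rw [eq_sub_iff_add_eq] at hD
    rw [← hD, hD']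
    simp only [id, Function.comp_apply, Pi.sub_apply, one_smul]
    abel
  have hcont : ContinuousOn (fun t => linHomotopy g₁ g₂ t (γ t)) (Icc 0 1) :=
    fun t ht => (hder t ht).continuousWithinAt
  obtain ⟨M, hM⟩ := isCompact_Icc.exists_bound_of_continuousOn hcont
  have hbound : ∀ t ∈ Icc (0 : ℝ) 1, ‖w t‖ ≤ 1 / (c * (δ / 2) ^ r) := by
    intro t ht
    obtain ⟨hn, hdist⟩ := hnear t ht
    have hpos : 0 < infDist (γ t) S := by linarith
    have b₁ := h.norm_kuoMultiplier_le (x := γ t) (by linarith) hpos ht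
    have b₂ := h.close (γ t) (by linarith)
    set m := c * infDist (γ t) S ^ r with hm
    have hm0 : 0 < m := by positivity
    have hle : c * (δ / 2) ^ r ≤ m := by rw [hm]; gcongr
    have b₃ : m * ‖w t‖ ≤ 1 := by
      have : m * (m * ‖w t‖) ≤ m * 1 := by
        calc m * (m * ‖w t‖) = m ^ 2 * ‖w t‖ := by ring
          _ ≤ 2 * ‖g₂ (γ t) - g₁ (γ t)‖ := b₁
          _ ≤ m * 1 := by linarith
      exact le_of_mul_le_mul_left this hm0
    rw [le_div_iff₀ (by positivity), mul_comm]
    calc _ ≤ m * ‖w t‖ := by gcongr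
      _ ≤ 1 := b₃
  have key := eq_zero_iff_of_norm_deriv_le hder (K := M * (1 / (c * (δ / 2) ^ r)))
    fun t ht => by
      have hM0 : 0 ≤ M := (norm_nonneg _).trans (hM t ht)
      rw [norm_smul, norm_pow, norm_norm, sq]
      calc _ ≤ M * ‖linHomotopy g₁ g₂ t (γ t)‖ * (1 / (c * (δ / 2) ^ r)) := by
            gcongr
            · exact hM t ht
            · exact hbound t ht
        _ = _ := by ring
  simpa [linHomotopy] using key

theorem exists_homeomorph (h : Nondegenerate g₁ g₂ S r R c) (hr : r ≠ 0) (h₁ : ContDiff ℝ 2 g₁)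
    (h₂ : ContDiff ℝ 2 g₂) (hS : IsClosed S) (h0 : (0 : E) ∈ S) :
    ∃ φ : E ≃ₜ E, (∀ x, ‖x‖ < R / 4 → (g₁ x = 0 ↔ g₂ (φ x) = 0)) ∧ ∀ x ∈ S, φ x = x := by
  have hW := h.controlledField h₁ h₂ hS h0
  have hR := h.radius_pos
  obtain ⟨φ, hφ⟩ := hW.exists_homeomorph (hS.union isOpen_ball.isClosed_compl) ⟨0, Or.inl h0⟩
  have hfix : ∀ x ∈ S, φ x = x := by
    intro x hx
    obtain ⟨γ, rfl, hγ1, hγ⟩ := hφ x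
    have := hW.dist_le hγ (t := 1) ⟨zero_le_one, le_rfl⟩
    rw [infDist_zero_of_mem (mem_union_left _ hx), zero_div, dist_le_zero] at this
    rw [← hγ1, this]
  refine ⟨φ, fun x hx => ?_, hfix⟩
  by_cases hxS : x ∈ S
  · have := h.close x (by linarith)
    rw [infDist_zero_of_mem hxS, zero_pow hr, mul_zero, norm_le_zero_iff, sub_eq_zero] at this
    rw [hfix x hxS, this]
  · obtain ⟨γ, rfl, hγ1, hγ⟩ := hφ x
    rw [← hγ1]
    exact h.linHomotopy_eq_zero_iff h₁ h₂ hS h0 hγ hx hxS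

end Nondegenerate

end Field
section Sufficiency

open Set Metric Topology Filter

lemma OpenPartialHomeomorph.exists_homeomorph_zeros {E F : Type*} [NormedAddCommGroup E]
    [NormedAddCommGroup F] (e : OpenPartialHomeomorph E E) (h0 : (0 : E) ∈ e.source)
    (he0 : e 0 = 0) {g₁ g₂ : E → F} {S : Set E}
    (he : ∀ᶠ x in 𝓝 0, (g₁ x = 0 ↔ g₂ (e x) = 0) ∧ (x ∈ S → e x = x)) :
    ∃ U ∈ 𝓝 (0 : E), ∃ V ∈ 𝓝 (0 : E), ∃ h : (g₁ ⁻¹' {0} ∩ U : Set E) ≃ₜ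
      (g₂ ⁻¹' {0} ∩ V : Set E), ∀ x : (g₁ ⁻¹' {0} ∩ U : Set E), (x : E) ∈ S → (h x : E) = x := by
  obtain ⟨N, hN, hNo, hN0⟩ := _root_.eventually_nhds_iff.1 he
  let e' := e.restrOpen N hNo
  have hs : ∀ x ∈ e'.source, x ∈ N := fun x hx => by
    rw [OpenPartialHomeomorph.restrOpen_source] at hx
    exact hx.2
  have hs0 : (0 : E) ∈ e'.source := by
    rw [OpenPartialHomeomorph.restrOpen_source]
    exact ⟨h0, hN0⟩
  have hco : ∀ x, e' x = e x := fun x => rfl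
  have ht0 : (0 : E) ∈ e'.target := by
    have := e'.map_source hs0
    rwa [hco, he0] at this
  refine ⟨_, e'.open_source.mem_nhds hs0, _, e'.open_target.mem_nhds ht0,
    { toFun := fun x => ⟨e' x, (hN _ (hs _ x.2.2)).1.1 x.2.1, e'.map_source x.2.2⟩
      invFun := fun y => ⟨e'.symm y, ?_, e'.map_target y.2.2⟩
      left_inv := fun x => Subtype.ext (e'.left_inv x.2.2)
      right_inv := fun y => Subtype.ext (e'.right_inv y.2.2)
      continuous_toFun := ?_
      continuous_invFun := ?_ }, fun x hx => (hN _ (hs _ x.2.2)).2 hx⟩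
  · refine (hN _ (hs _ (e'.map_target y.2.2))).1.2 ?_
    rw [← hco, e'.right_inv y.2.2]
    exact y.2.1
  · exact (e'.continuousOn.comp_continuous continuous_subtype_val fun x => x.2.2).subtype_mk _
  · exact (e'.symm.continuousOn.comp_continuous continuous_subtype_val
      fun x => x.2.2).subtype_mk _

lemma jetEqual.flat {n p r : ℕ} {S : Set (EuclideanSpace ℝ (Fin n))}
    {f g : EuclideanSpace ℝ (Fin n) → EuclideanSpace ℝ (Fin p)} (h : jetEqual r S f g)
    (hf : ContDiff ℝ r f) (hg : ContDiff ℝ r g) :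
    ∃ U ∈ 𝓝 0, ∀ z ∈ S ∩ U, ∀ k ≤ r, iteratedFDeriv ℝ k (g - f) z = 0 := by
  obtain ⟨U, hU, h⟩ := h
  refine ⟨U, hU, fun z hz k hk => ?_⟩
  have hk' : (k : WithTop ℕ∞) ≤ r := by exact_mod_cast hk
  rw [iteratedFDeriv_sub_apply (hg.of_le hk').contDiffAt (hf.of_le hk').contDiffAt,
    h z hz k hk, sub_self]

lemma jetEqual.exists_close {n p r : ℕ} {S : Set (EuclideanSpace ℝ (Fin n))} (hS : IsClosed S)
    (h0 : 0 ∈ S) (hr : 1 ≤ r) {f g : EuclideanSpace ℝ (Fin n) → EuclideanSpace ℝ (Fin p)}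
    (h : jetEqual r S f g) (hf : ContDiff ℝ r f) (hg : ContDiff ℝ r g) {ε : ℝ} (hε : 0 < ε) :
    ∃ R > 0, ∀ x, ‖x‖ < R → ‖g x - f x‖ ≤ ε * infDist x S ^ r ∧
      ‖fderiv ℝ g x - fderiv ℝ f x‖ ≤ ε * infDist x S ^ (r - 1) := by
  obtain ⟨R, hR, hb⟩ := norm_le_of_flat hS h0 hr (hg.sub hf) (h.flat hf hg) hε
  have hr' : (r : WithTop ℕ∞) ≠ 0 := by exact_mod_cast (show r ≠ 0 by omega)
  refine ⟨R, hR, fun x hx => ⟨(hb x hx).1, ?_⟩⟩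
  have := (hb x hx).2
  rwa [fderiv_fun_sub (hg.differentiable hr' x) (hf.differentiable hr' x)] at this

lemma norm_add_smul_sub_sub_le {G : Type*} [NormedAddCommGroup G] [NormedSpace ℝ G] {a b y : G}
    {δ t : ℝ} (ht : t ∈ Icc (0 : ℝ) 1) (ha : ‖a - y‖ ≤ δ) (hb : ‖b - y‖ ≤ δ) :
    ‖a + t • (b - a) - y‖ ≤ δ := by
  have := (convex_closedBall y δ).add_smul_sub_mem (mem_closedBall_iff_norm.2 ha)
    (mem_closedBall_iff_norm.2 hb) ht
  exact mem_closedBall_iff_norm.1 this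

lemma KuoTildeRel.exists_nondegenerate {n p r : ℕ} (hr : 1 ≤ r) (hp : 1 ≤ p)
    {S : Set (EuclideanSpace ℝ (Fin n))} (hS : IsClosed S) (h0 : 0 ∈ S)
    {f g₁ g₂ : EuclideanSpace ℝ (Fin n) → EuclideanSpace ℝ (Fin p)} (hf : ContDiff ℝ r f)
    (hK : KuoTildeRel r S f) (hg₁ : ContDiff ℝ r g₁) (hg₂ : ContDiff ℝ r g₂)
    (h₁ : jetEqual r S f g₁) (h₂ : jetEqual r S f g₂) :
    ∃ R c, Nondegenerate g₁ g₂ S r R c := by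
  obtain ⟨c, hc, α, hα, hl⟩ := hK.exists_lower_bound hp
  obtain ⟨R₁, hR₁, b₁⟩ := h₁.exists_close hS h0 hr hf hg₁ (ε := c / 128) (by positivity)
  obtain ⟨R₂, hR₂, b₂⟩ := h₂.exists_close hS h0 hr hf hg₂ (ε := c / 128) (by positivity)
  refine ⟨min α (min R₁ R₂), c / 2, by positivity, by positivity, fun x hx t ht w => ?_,
    fun x hx => ?_⟩
  all_goals
    obtain ⟨hxα, hx₁, hx₂⟩ : ‖x‖ < α ∧ ‖x‖ < R₁ ∧ ‖x‖ < R₂ := by simpa using hx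
    have hd : 0 ≤ infDist x S := infDist_nonneg
  · refine le_trans ?_ (lower_bound_of_close hd hr
      (norm_add_smul_sub_sub_le ht (b₁ x hx₁).2 (b₂ x hx₂).2)
      (norm_add_smul_sub_sub_le ht (b₁ x hx₁).1 (b₂ x hx₂).1) (hl x hxα w))
    gcongr
    linarith
  · have e : g₂ x - g₁ x = (g₂ x - f x) - (g₁ x - f x) := by abel
    rw [e]
    refine (norm_sub_le _ _).trans ?_
    have := (b₁ x hx₁).1
    have := (b₂ x hx₂).1
    linarith

lemma exists_straightening {E F : Type*} [NormedAddCommGroup E] [NormedSpace ℝ E] [CompleteSpace E]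
    [NormedAddCommGroup F] [NormedSpace ℝ F] {g : E → F} {L : E →L[ℝ] F} (A : F →L[ℝ] E)
    (hg : HasStrictFDerivAt g L 0) :
    ∃ e : OpenPartialHomeomorph E E, 0 ∈ e.source ∧ ∀ x, e x = x + A (g x - L x) := by
  have h : HasStrictFDerivAt (fun x => x + A (g x - L x))
      ((ContinuousLinearEquiv.refl ℝ E : E ≃L[ℝ] E) : E →L[ℝ] E) 0 := by
    refine ((hasStrictFDerivAt_id (0 : E)).add
      (A.hasStrictFDerivAt.comp 0 (hg.sub L.hasStrictFDerivAt))).congr_fderiv ?_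
    ext x
    simp
  exact ⟨h.toOpenPartialHomeomorph _, h.mem_toOpenPartialHomeomorph_source, fun x => rfl⟩

lemma exists_openPartialHomeomorph_of_surjective {E F : Type*} [NormedAddCommGroup E]
    [NormedSpace ℝ E] [CompleteSpace E] [NormedAddCommGroup F] [NormedSpace ℝ F] {g₁ g₂ : E → F}
    {L : E →L[ℝ] F} {A : F →L[ℝ] E} (hA : ∀ y, L (A y) = y) (h₁ : HasStrictFDerivAt g₁ L 0)
    (h₂ : HasStrictFDerivAt g₂ L 0) (h0 : g₁ 0 = g₂ 0) {S : Set E}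
    (hS : ∀ᶠ x in 𝓝 0, x ∈ S → g₁ x = g₂ x) :
    ∃ e : OpenPartialHomeomorph E E, 0 ∈ e.source ∧ e 0 = 0 ∧
      ∀ᶠ x in 𝓝 0, (g₁ x = 0 ↔ g₂ (e x) = 0) ∧ (x ∈ S → e x = x) := by
  obtain ⟨e₁, hs₁, he₁⟩ := exists_straightening A h₁
  obtain ⟨e₂, hs₂, he₂⟩ := exists_straightening A h₂
  have hL₁ : ∀ x, L (e₁ x) = g₁ x := fun x => by simp [he₁, hA]
  have hL₂ : ∀ x, L (e₂ x) = g₂ x := fun x => by simp [he₂, hA]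
  have h00 : e₁ 0 = e₂ 0 := by rw [he₁, he₂, h0]
  have hmem : (0 : E) ∈ (e₁.trans e₂.symm).source := by
    rw [OpenPartialHomeomorph.trans_source]
    refine ⟨hs₁, ?_⟩
    rw [mem_preimage, h00]
    exact e₂.map_source hs₂
  refine ⟨e₁.trans e₂.symm, hmem, ?_, ?_⟩
  · rw [OpenPartialHomeomorph.trans_apply, h00, e₂.left_inv hs₂]
  · filter_upwards [hS, e₂.open_source.mem_nhds hs₂,
      (e₁.trans e₂.symm).open_source.mem_nhds hmem] with x hxS hx₂ hx
    rw [OpenPartialHomeomorph.trans_source] at hx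
    rw [OpenPartialHomeomorph.trans_apply]
    refine ⟨?_, fun hm => ?_⟩
    · rw [← hL₁, ← hL₂, e₂.right_inv hx.2]
    · rw [show e₁ x = e₂ x by rw [he₁, he₂, hxS hm], e₂.left_inv hx₂]

lemma jetEqual.eventually_eq {n p r : ℕ} {S : Set (EuclideanSpace ℝ (Fin n))}
    {f g : EuclideanSpace ℝ (Fin n) → EuclideanSpace ℝ (Fin p)} (h : jetEqual r S f g) :
    ∀ᶠ x in 𝓝 0, x ∈ S → f x = g x := by
  obtain ⟨U, hU, h⟩ := h
  filter_upwards [hU] with x hx hxS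
  have := DFunLike.congr_fun (h x ⟨hxS, hx⟩ 0 (Nat.zero_le r)) 0
  simpa using this

lemma KuoTildeRel.eventually_mem_of_adjoint_eq_zero {n p : ℕ} (hp : 1 ≤ p)
    {S : Set (EuclideanSpace ℝ (Fin n))} (hS : IsClosed S) (h0 : 0 ∈ S)
    {f : EuclideanSpace ℝ (Fin n) → EuclideanSpace ℝ (Fin p)} (hf : ContDiff ℝ 1 f)
    (hK : KuoTildeRel 1 S f) {w : EuclideanSpace ℝ (Fin p)} (hw : w ≠ 0)
    (hLw : ContinuousLinearMap.adjoint (fderiv ℝ f 0) w = 0)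
    {g : EuclideanSpace ℝ (Fin n) → EuclideanSpace ℝ (Fin p)} (hg : ContDiff ℝ 1 g)
    (h : jetEqual 1 S f g) : ∀ᶠ x in 𝓝 0, g x = 0 → x ∈ S := by
  obtain ⟨c, hc, α, hα, hl⟩ := hK.exists_lower_bound hp
  obtain ⟨R, hR, b⟩ := h.exists_close hS h0 le_rfl hf hg (ε := c / 4) (by positivity)
  have hcont : Continuous fun x => ‖ContinuousLinearMap.adjoint (fderiv ℝ f x) w‖ := by
    have h1 : Continuous (fderiv ℝ f) := hf.continuous_fderiv (by norm_num)
    have h2 : Continuous fun x => ContinuousLinearMap.adjoint (fderiv ℝ f x) :=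
      ContinuousLinearMap.adjoint.continuous.comp h1
    exact (h2.clm_apply continuous_const).norm
  have hwn : 0 < ‖w‖ := norm_pos_iff.2 hw
  have hsmall : ∀ᶠ x in 𝓝 0, ‖ContinuousLinearMap.adjoint (fderiv ℝ f x) w‖ < c / 2 * ‖w‖ := by
    refine hcont.continuousAt.eventually_lt_const ?_
    simpa [hLw] using mul_pos (half_pos hc) hwn
  filter_upwards [hsmall, ball_mem_nhds 0 hα, ball_mem_nhds 0 hR] with x hx hxα hxR hgx
  rw [mem_ball_zero_iff] at hxα hxR
  have h1 := hl x hxα w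
  have h2 := (b x hxR).1
  rw [hgx, zero_sub, norm_neg, pow_one] at h2
  rw [pow_one] at h1
  by_contra hxS
  have hd : 0 < infDist x S := (hS.notMem_iff_infDist_pos ⟨0, h0⟩).1 hxS
  have h3 : infDist x S * ‖ContinuousLinearMap.adjoint (fderiv ℝ f x) w‖ ≤
      infDist x S * (c / 2 * ‖w‖) := by gcongr
  have h4 : ‖f x‖ * ‖w‖ ≤ c / 4 * infDist x S * ‖w‖ := by gcongr
  have h5 : 0 < c * infDist x S * ‖w‖ := by positivity
  linarith

lemma KuoTildeRel.exists_openPartialHomeomorph_one {n p : ℕ} (hp : 1 ≤ p)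
    {S : Set (EuclideanSpace ℝ (Fin n))} (hS : IsClosed S) (h0 : 0 ∈ S)
    {f g₁ g₂ : EuclideanSpace ℝ (Fin n) → EuclideanSpace ℝ (Fin p)} (hf : ContDiff ℝ 1 f)
    (hK : KuoTildeRel 1 S f) (hg₁ : ContDiff ℝ 1 g₁) (hg₂ : ContDiff ℝ 1 g₂)
    (h₁ : jetEqual 1 S f g₁) (h₂ : jetEqual 1 S f g₂) :
    ∃ e : OpenPartialHomeomorph (EuclideanSpace ℝ (Fin n)) (EuclideanSpace ℝ (Fin n)),
      0 ∈ e.source ∧ e 0 = 0 ∧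
      ∀ᶠ x in 𝓝 0, (g₁ x = 0 ↔ g₂ (e x) = 0) ∧ (x ∈ S → e x = x) := by
  have heq : ∀ᶠ x in 𝓝 0, x ∈ S → g₁ x = g₂ x := by
    filter_upwards [h₁.eventually_eq, h₂.eventually_eq] with x e₁ e₂ hx
    rw [← e₁ hx, e₂ hx]
  by_cases hL : ∃ w ≠ 0, ContinuousLinearMap.adjoint (fderiv ℝ f 0) w = 0
  · obtain ⟨w, hw, hLw⟩ := hL
    refine ⟨OpenPartialHomeomorph.refl _, mem_univ _, rfl, ?_⟩
    filter_upwards [heq, hK.eventually_mem_of_adjoint_eq_zero hp hS h0 hf hw hLw hg₁ h₁,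
      hK.eventually_mem_of_adjoint_eq_zero hp hS h0 hf hw hLw hg₂ h₂] with x he m₁ m₂
    refine ⟨⟨fun hx => ?_, fun hx => ?_⟩, fun _ => rfl⟩
    · exact (he (m₁ hx)).symm.trans hx
    · exact (he (m₂ hx)).trans hx
  · push Not at hL
    have hsurj : (fderiv ℝ f 0).range = ⊤ := by
      rw [← Submodule.orthogonal_eq_bot_iff, ContinuousLinearMap.orthogonal_range, eq_bot_iff]
      intro w hw
      by_contra hne
      exact hL w hne hw
    obtain ⟨A, hA⟩ := ContinuousLinearMap.exists_rightInverse_of_surjective _ hsurj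
    have hder : ∀ g, ContDiff ℝ 1 g → jetEqual 1 S f g → HasStrictFDerivAt g (fderiv ℝ f 0) 0 := by
      intro g hg h
      obtain ⟨U, hU, h⟩ := h
      have e : fderiv ℝ f 0 = fderiv ℝ g 0 := by
        ext1 v
        simpa [iteratedFDeriv_one_apply] using
          DFunLike.congr_fun (h 0 ⟨h0, mem_of_mem_nhds hU⟩ 1 le_rfl) fun _ => v
      rw [e]
      exact hg.contDiffAt.hasStrictFDerivAt one_ne_zero
    exact exists_openPartialHomeomorph_of_surjective (fun y => DFunLike.congr_fun hA y)
      (hder g₁ hg₁ h₁) (hder g₂ hg₂ h₂) (heq.self_of_nhds h0) heq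

end Sufficiency

/-- If `f` satisfies `(K̃_Σ)` then `j^r f(Σ;0)` is `Σ`-`V`-sufficient in `C^r` mappings. -/
theorem stmt16 {n p r : ℕ} (hr : 1 ≤ r) (hp : 1 ≤ p) (hnp : p ≤ n)
    (S : Set (EuclideanSpace ℝ (Fin n)))
    (hS : IsClosed S) (h0S : (0 : EuclideanSpace ℝ (Fin n)) ∈ S)
    (f : EuclideanSpace ℝ (Fin n) → EuclideanSpace ℝ (Fin p))
    (hf : ContDiff ℝ r f) (hf0 : f 0 = 0)
    (hKt : KuoTildeRel r S f) :
    SigmaVSufficient r r S f := by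
  intro g₁ g₂ hg₁ hg₂ _ _ h₁ h₂
  obtain ⟨e, hs, he0, he⟩ : ∃ e : OpenPartialHomeomorph (EuclideanSpace ℝ (Fin n))
      (EuclideanSpace ℝ (Fin n)), 0 ∈ e.source ∧ e 0 = 0 ∧
      ∀ᶠ x in nhds 0, (g₁ x = 0 ↔ g₂ (e x) = 0) ∧ (x ∈ S → e x = x) := by
    obtain rfl | hr2 := hr.eq_or_lt
    · exact hKt.exists_openPartialHomeomorph_one hp hS h0S hf hg₁ hg₂ h₁ h₂
    · obtain ⟨R, c, hnd⟩ := hKt.exists_nondegenerate hr hp hS h0S hf hg₁ hg₂ h₁ h₂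
      have h2r : (2 : WithTop ℕ∞) ≤ r := by exact_mod_cast hr2
      obtain ⟨φ, hφ, hφS⟩ := hnd.exists_homeomorph (by omega) (hg₁.of_le h2r) (hg₂.of_le h2r)
        hS h0S
      refine ⟨φ.toOpenPartialHomeomorph, Set.mem_univ _, hφS 0 h0S, ?_⟩
      filter_upwards [Metric.ball_mem_nhds 0 (show 0 < R / 4 by linarith [hnd.radius_pos])]
        with x hx
      exact ⟨hφ x (mem_ball_zero_iff.1 hx), hφS x⟩
  exact e.exists_homeomorph_zeros hs he0 he
end
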